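/- Let K be an annular continuum with empty interior in an annulus A. Then K contains a unique frontier: there is a unique subcontinuum K̂ ⊂ K which is itself an annular continuum satisfying K̂ = ∂⁻K̂ = ∂⁺K̂. -/

import Mathlib

open Set Topology Filter

noncomputable section

/-- The circle `ℝ/ℤ`. -/
abbrev Circ : Type := AddCircle (1 : ℝ)

/-- The open annulus `S¹ × ℝ`. -/
abbrev Ann : Type := Circ × ℝ

/-- The standard closed annulus `S¹ × [0,1]` inside `Ann`. -/
def stdA : Set Ann := {p | p.2 ∈ Icc (0:ℝ) 1}

/-- The lower boundary circle of the standard closed annulus. -/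
def bdLow : Set Ann := {p | p.2 = 0}

/-- The upper boundary circle of the standard closed annulus. -/
def bdHigh : Set Ann := {p | p.2 = 1}

/-- The half-open model annulus `S¹ × [0,1)`. -/
def halfOpenAnn : Set Ann := {p | p.2 ∈ Ico (0:ℝ) 1}

/-- `W` has exactly two connected components, `Km` and `Kp`. -/
def TwoComponents (W Km Kp : Set Ann) : Prop :=
  Km ≠ Kp ∧ Km ∪ Kp = W ∧
  (∃ x ∈ W, connectedComponentIn W x = Km) ∧
  (∃ x ∈ W, connectedComponentIn W x = Kp) ∧
  ∀ x ∈ W, connectedComponentIn W x = Km ∨ connectedComponentIn W x = Kp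

/-- `K` is an annular continuum in the standard closed annulus, with complementary
pieces `Km` (containing the lower boundary) and `Kp` (containing the upper boundary),
each homeomorphic to a (half-open) annulus. -/
def AnnularContinuum (K Km Kp : Set Ann) : Prop :=
  IsCompact K ∧ IsConnected K ∧ K ⊆ stdA ∧
  TwoComponents (stdA \ K) Km Kp ∧
  bdLow ⊆ Km ∧ bdHigh ⊆ Kp ∧
  Nonempty (↥Km ≃ₜ ↥halfOpenAnn) ∧ Nonempty (↥Kp ≃ₜ ↥halfOpenAnn)

/-- The boundary in the standard closed annulus of a relatively open subset. -/
def relBd (E : Set Ann) : Set Ann := closure E \ E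

/-- `K` is a frontier: an annular continuum which coincides with the boundary of each of
its two complementary pieces. -/
def IsFrontierSet (K : Set Ann) : Prop :=
  ∃ Km Kp, AnnularContinuum K Km Kp ∧ K = relBd Km ∧ K = relBd Kp

/-- On a preconnected set, a continuous function with `exp ∘ u = 1` is constant. -/
theorem IsPreconnected.eq_of_exp_eq_one {X : Type*} [TopologicalSpace X] {S : Set X}
    (hS : IsPreconnected S) {u : X → ℂ} (hu : ContinuousOn u S)
    (h1 : ∀ x ∈ S, Complex.exp (u x) = 1) {x y : X} (hx : x ∈ S) (hy : y ∈ S) : u x = u y := by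
  have hd : IsDiscrete (AddSubgroup.zmultiples (2 * (Real.pi : ℂ) * Complex.I) : Set ℂ) :=
    ⟨NormedSpace.discreteTopology_zmultiples _⟩
  refine hS.constant_of_mapsTo hd hu (fun z hz => ?_) hx hy
  obtain ⟨n, hn⟩ := Complex.exp_eq_one_iff.1 (h1 z hz)
  exact AddSubgroup.mem_zmultiples_iff.2 ⟨n, by rw [hn, zsmul_eq_mul]⟩

/-- The complex plane is unicoherent. -/
theorem isPreconnected_inter_of_union_eq_univ {A B : Set ℂ} (hA : IsClosed A) (hB : IsClosed B)
    (hAc : IsPreconnected A) (hBc : IsPreconnected B) (hAB : A ∪ B = univ) :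
    IsPreconnected (A ∩ B) := by
  classical
  rw [isPreconnected_closed_iff]
  intro t t' ht ht' hcov hnt hnt'
  by_contra hemp
  rw [not_nonempty_iff_eq_empty] at hemp
  have hC : IsClosed (A ∩ B ∩ t) := (hA.inter hB).inter ht
  have hD : IsClosed (A ∩ B ∩ t') := (hA.inter hB).inter ht'
  have hdisj : Disjoint (A ∩ B ∩ t) (A ∩ B ∩ t') := by
    rw [Set.disjoint_left]
    intro x hx hx'
    have : x ∈ A ∩ B ∩ (t ∩ t') := ⟨hx.1, hx.2, hx'.2⟩
    rw [hemp] at this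
    exact this
  obtain ⟨f, hf0, hf1, -⟩ := exists_continuous_zero_one_of_isClosed hC hD hdisj
  let w : ℂ → ℂ := fun z => (f z : ℂ) * (Real.pi * Complex.I)
  have hw : Continuous w := by fun_prop
  let g : ℂ → ℂ := fun z => if z ∈ A then Complex.exp (w z) else Complex.exp (-w z)
  have hgA : ∀ z ∈ A, g z = Complex.exp (w z) := fun z hz => if_pos hz
  have hgB : ∀ z ∈ B, g z = Complex.exp (-w z) := by
    intro z hz
    by_cases hzA : z ∈ A
    · rw [hgA z hzA]
      rcases hcov ⟨hzA, hz⟩ with h | h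
      · have : f z = 0 := hf0 ⟨⟨hzA, hz⟩, h⟩
        simp [w, this]
      · have : f z = 1 := hf1 ⟨⟨hzA, hz⟩, h⟩
        simp [w, this, Complex.exp_neg]
    · exact if_neg hzA
  have hg : ContinuousOn g univ := by
    rw [← hAB]
    refine ContinuousOn.union_of_isClosed ?_ ?_ hA hB
    · exact (Complex.continuous_exp.comp hw).continuousOn.congr hgA
    · exact (Complex.continuous_exp.comp hw.neg).continuousOn.congr hgB
  have hg0 : (0 : ℂ) ∉ g '' univ := by
    rintro ⟨z, -, hz⟩
    by_cases hzA : z ∈ A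
    · rw [hgA z hzA] at hz
      exact Complex.exp_ne_zero _ hz
    · exact Complex.exp_ne_zero _ ((if_neg hzA).symm.trans hz)
  have hsc : IsSimplyConnected (univ : Set ℂ) := by
    have : ContractibleSpace (univ : Set ℂ) :=
      (convex_univ (𝕜 := ℝ) (E := ℂ)).contractibleSpace univ_nonempty
    exact SimplyConnectedSpace.ofContractible _
  obtain ⟨l, hlc, hl⟩ := Complex.exists_continuousOn_eqOn_exp_comp hsc isOpen_univ hg hg0
  rw [← continuousOn_univ] at hw
  obtain ⟨c, hc, hct⟩ := hnt
  obtain ⟨d, hd, hdt⟩ := hnt'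
  have h1 := hAc.eq_of_exp_eq_one (u := fun z => l z - w z)
    ((hlc.sub hw).mono (subset_univ _)) (fun z hz => by
      have := hl (mem_univ z)
      simp only [Function.comp] at this
      rw [Complex.exp_sub, this, hgA z hz, div_self (Complex.exp_ne_zero _)]) hc.1 hd.1
  have h2 := hBc.eq_of_exp_eq_one (u := fun z => l z + w z)
    ((hlc.add hw).mono (subset_univ _)) (fun z hz => by
      have := hl (mem_univ z)
      simp only [Function.comp] at this
      rw [Complex.exp_add, this, hgB z hz, ← Complex.exp_add, neg_add_cancel,
        Complex.exp_zero]) hc.2 hd.2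
  have hc0 : f c = 0 := hf0 ⟨hc, hct⟩
  have hd1 : f d = 1 := hf1 ⟨hd, hdt⟩
  simp only [w, hc0, hd1] at h1 h2
  have : (Real.pi : ℂ) * Complex.I = 0 := by
    push_cast at h1 h2
    linear_combination (h2 - h1) * (-1 / 2)
  simp [Real.pi_ne_zero] at this

/-- A function with values in the slit plane has a continuous square root. -/
theorem exists_continuousOn_sq_eq_of_mem_slitPlane {Γ : Set ℂ} {f : ℂ → ℂ}
    (hf : ContinuousOn f Γ) (hs : ∀ z ∈ Γ, f z ∈ Complex.slitPlane) :
    ∃ S : ℂ → ℂ, ContinuousOn S Γ ∧ ∀ z ∈ Γ, S z ^ 2 = f z := by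
  refine ⟨fun z => Complex.exp (Complex.log (f z) / 2), ?_, fun z hz => ?_⟩
  · exact Complex.continuous_exp.comp_continuousOn ((hf.clog hs).div_const _)
  · rw [← Complex.exp_nat_mul]
    push_cast
    rw [mul_div_cancel₀ _ two_ne_zero, Complex.exp_log (Complex.slitPlane_ne_zero (hs z hz))]

/-- If a connected set containing `0` and `1` misses a closed subset `Γ` of the unit disc, then
the identity has a continuous square root on `Γ`. -/
theorem exists_continuousOn_sq_eq_id {C Γ : Set ℂ} (hC : IsPreconnected C)
    (hΓ : IsClosed Γ) (hdisj : Disjoint C Γ) (h0 : (0 : ℂ) ∈ C) (h1 : (1 : ℂ) ∈ C)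
    (hb : ∀ z ∈ Γ, ‖z‖ < 1) :
    ∃ S : ℂ → ℂ, ContinuousOn S Γ ∧ ∀ z ∈ Γ, S z ^ 2 = z := by
  have hne : ∀ z ∈ Γ, ∀ x ∈ C, z - x ≠ 0 := fun z hz x hx h =>
    Set.disjoint_left.1 hdisj hx (by rwa [← sub_eq_zero.1 h])
  have key : ∃ S : ℂ → ℂ, ContinuousOn S Γ ∧ ∀ z ∈ Γ, S z ^ 2 = (z - 0) / (z - 1) := by
    refine hC.induction₂ (fun x y => ∃ S : ℂ → ℂ, ContinuousOn S Γ ∧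
      ∀ z ∈ Γ, S z ^ 2 = (z - y) / (z - x)) ?_ ?_ ?_ h1 h0
    · intro x hx
      have hx' : x ∈ Γᶜ := Set.disjoint_left.1 hdisj hx
      obtain ⟨δ, hδ, hball⟩ := Metric.isOpen_iff.1 hΓ.isOpen_compl x hx'
      filter_upwards [mem_nhdsWithin_of_mem_nhds (Metric.ball_mem_nhds x hδ)] with y hy
      refine exists_continuousOn_sq_eq_of_mem_slitPlane ?_ ?_
      · exact (continuousOn_id.sub continuousOn_const).div
          (continuousOn_id.sub continuousOn_const) (fun z hz => hne z hz x hx)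
      · intro z hz
        have hzx := hne z hz x hx
        have : (z - y) / (z - x) = 1 + (x - y) / (z - x) := by
          field_simp
          ring
        rw [this]
        apply Complex.mem_slitPlane_of_norm_lt_one
        rw [norm_div, div_lt_one (norm_pos_iff.2 hzx)]
        have hz1 : δ ≤ dist z x := by
          by_contra hlt
          exact hball (Metric.mem_ball.2 (not_le.1 hlt)) hz
        rw [Metric.mem_ball, dist_comm, dist_eq_norm] at hy
        rw [dist_eq_norm] at hz1
        linarith
    · rintro x y w hx hy hw ⟨S, hS, hS'⟩ ⟨T, hT, hT'⟩
      refine ⟨fun z => S z * T z, hS.mul hT, fun z hz => ?_⟩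
      have := hne z hz x hx
      have := hne z hz y hy
      rw [mul_pow, hS' z hz, hT' z hz]
      field_simp
    · rintro x y hx hy ⟨S, hS, hS'⟩
      refine ⟨fun z => (S z)⁻¹, hS.inv₀ fun z hz h => ?_, fun z hz => ?_⟩
      · have := hS' z hz
        rw [h] at this
        exact div_ne_zero (hne z hz y hy) (hne z hz x hx) (by rw [← this]; simp)
      · rw [inv_pow, hS' z hz, inv_div]
  obtain ⟨S, hS, hS'⟩ := key
  obtain ⟨T, hT, hT'⟩ := exists_continuousOn_sq_eq_of_mem_slitPlane (Γ := Γ) (f := fun z => 1 + -z)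
    (by fun_prop) (fun z hz => Complex.mem_slitPlane_of_norm_lt_one (by rw [norm_neg]; exact hb z hz))
  refine ⟨fun z => S z * T z * Complex.I, (hS.mul hT).mul continuousOn_const, fun z hz => ?_⟩
  have := hne z hz 1 h1
  rw [mul_pow, mul_pow, hS' z hz, hT' z hz, Complex.I_sq]
  field_simp
  ring

/-- A connected open subset of the unit disc whose complement in the closed disc is connected. -/
structure IsDiscDomain (Ω : Set ℂ) : Prop where
  isOpen : IsOpen Ω
  isPreconnected : IsPreconnected Ω
  subset_ball : Ω ⊆ Metric.ball 0 1
  nonempty : Ω.Nonempty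
  compl : IsPreconnected (Metric.closedBall 0 1 \ Ω)

/-- The preimage under squaring of a compact connected set containing the origin is connected. -/
theorem isPreconnected_sq_preimage {C : Set ℂ} (hC : IsPreconnected C) (hCc : IsClosed C)
    (h0 : (0 : ℂ) ∈ C) : IsPreconnected ((fun z : ℂ => z ^ 2) ⁻¹' C) := by
  have hop : IsOpenMap (fun z : ℂ => z ^ 2) := (Complex.isOpenQuotientMap_pow 2).isOpenMap
  have hcont : Continuous (fun z : ℂ => z ^ 2) := by fun_prop
  have hcl : IsClosedMap (fun z : ℂ => z ^ 2) := by
    have := (Polynomial.X ^ 2 : Polynomial ℂ).isClosedMap_eval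
    simpa using this
  rw [isPreconnected_iff_subset_of_disjoint_closed]
  have main : ∀ u v : Set ℂ, IsClosed u → IsClosed v →
      (fun z : ℂ => z ^ 2) ⁻¹' C ⊆ u ∪ v → (fun z : ℂ => z ^ 2) ⁻¹' C ∩ (u ∩ v) = ∅ → (0 : ℂ) ∈ u →
      (fun z : ℂ => z ^ 2) ⁻¹' C ⊆ u := by
    intro u v hu hv huv hd h0u
    by_contra hns
    obtain ⟨x, hxC, hxu⟩ := not_subset.1 hns
    have hxv : x ∈ v := (huv hxC).resolve_left hxu
    have hDc : IsClosed ((fun z : ℂ => z ^ 2) ⁻¹' C) := hCc.preimage hcont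
    obtain ⟨O, hO, hvO, hOu⟩ := normal_exists_closure_subset (hDc.inter hv)
      (hDc.inter hu).isOpen_compl (fun y hy hy' => by
        have : y ∈ (fun z : ℂ => z ^ 2) ⁻¹' C ∩ (u ∩ v) := ⟨hy.1, hy'.2, hy.2⟩
        rwa [hd] at this)
    have hsub : C ⊆ (fun z : ℂ => z ^ 2) '' O := by
      refine hC.subset_of_closure_inter_subset (hop _ hO)
        ⟨x ^ 2, hxC, x, hvO ⟨hxC, hxv⟩, rfl⟩ ?_
      rintro w ⟨hw, hwC⟩
      obtain ⟨y, hy, rfl⟩ := hcl.closure_image_subset O hw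
      exact ⟨y, hvO ⟨hwC, (huv hwC).resolve_left fun h => hOu hy ⟨hwC, h⟩⟩, rfl⟩
    obtain ⟨y, hy, hy0⟩ := hsub h0
    have : y = 0 := by simpa using hy0
    rw [this] at hy
    exact hOu (subset_closure hy) ⟨by simpa using h0, h0u⟩
  intro u v hu hv huv hd
  rcases huv (show (0 : ℂ) ∈ (fun z : ℂ => z ^ 2) ⁻¹' C by simpa using h0) with h | h
  · exact Or.inl (main u v hu hv huv hd h)
  · exact Or.inr (main v u hv hu (by rwa [union_comm]) (by rwa [inter_comm v]) h)

/-- The component of the squaring preimage of a disc domain missing `0` is disjoint from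
its negative. -/
theorem IsDiscDomain.neg_notMem_of_isPreconnected {Ω : Set ℂ} (h : IsDiscDomain Ω)
    (h0 : (0 : ℂ) ∉ Ω) {U : Set ℂ} (hU : IsOpen U) (hUc : IsPreconnected U)
    (hUΩ : ∀ z ∈ U, z ^ 2 ∈ Ω) {z : ℂ} (hz : z ∈ U) : -z ∉ U := by
  intro hz'
  have hpc : IsPathConnected U := hU.isConnected_iff_isPathConnected.1 ⟨⟨z, hz⟩, hUc⟩
  obtain ⟨γ, hγ⟩ := hpc.joinedIn z hz (-z) hz'
  have hγc : Continuous (fun t => γ t ^ 2) := γ.continuous.pow 2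
  obtain ⟨S, hS, hS2⟩ := exists_continuousOn_sq_eq_id (Γ := range fun t => γ t ^ 2) h.compl
    (isCompact_range hγc).isClosed
    (by
      rw [Set.disjoint_left]
      rintro _ hx ⟨t, rfl⟩
      exact hx.2 (hUΩ _ (hγ t)))
    ⟨by simp, h0⟩ ⟨by simp, fun h1 => by simpa using h.subset_ball h1⟩
    (by
      rintro _ ⟨t, rfl⟩
      simpa using h.subset_ball (hUΩ _ (hγ t)))
  have hne : ∀ t, γ t ≠ 0 := fun t ht => h0 (by simpa [ht] using hUΩ _ (hγ t))
  let q : unitInterval → ℂ := fun t => S (γ t ^ 2) / γ t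
  have hq : Continuous q := by
    refine Continuous.div ?_ γ.continuous hne
    exact hS.comp_continuous hγc fun t => mem_range_self t
  have hq1 : ∀ t, q t ^ 2 = 1 := fun t => by
    simp only [q]
    rw [div_pow, hS2 _ (mem_range_self t), div_self (pow_ne_zero 2 (hne t))]
  have hconst : q 0 = q 1 := by
    refine isPreconnected_univ.constant_of_mapsTo (T := ({1, -1} : Set ℂ)) ?_ hq.continuousOn
      (fun t _ => ?_) (mem_univ _) (mem_univ _)
    · exact (Set.toFinite _).isDiscrete
    · rcases sq_eq_sq_iff_eq_or_eq_neg.1 ((hq1 t).trans (one_pow 2).symm) with h | h <;> simp [h]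
  simp only [q, γ.source, γ.target, neg_sq, div_neg] at hconst
  have hz0 : z ≠ 0 := by simpa using hne 0
  have h2 : S (z ^ 2) / z = 0 := by linear_combination hconst / 2
  have h3 := hq1 0
  simp only [q, γ.source, h2] at h3
  simp at h3

/-- A disc domain missing `0` has a holomorphic square root whose image is a disc domain. -/
theorem IsDiscDomain.exists_sqrt {Ω : Set ℂ} (h : IsDiscDomain Ω) (h0 : (0 : ℂ) ∉ Ω) :
    ∃ s : ℂ → ℂ, DifferentiableOn ℂ s Ω ∧ (∀ z ∈ Ω, s z ^ 2 = z) ∧ IsDiscDomain (s '' Ω) := by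
  have hop : IsOpenMap (fun z : ℂ => z ^ 2) := (Complex.isOpenQuotientMap_pow 2).isOpenMap
  have hsurj : Function.Surjective (fun z : ℂ => z ^ 2) := (Complex.isOpenQuotientMap_pow 2).surjective
  have hcont : Continuous (fun z : ℂ => z ^ 2) := by fun_prop
  set P : Set ℂ := (fun z : ℂ => z ^ 2) ⁻¹' Ω with hP
  have hPo : IsOpen P := h.isOpen.preimage hcont
  have hPneg : ∀ z, z ∈ P → -z ∈ P := fun z hz => by simpa [hP] using hz
  obtain ⟨w0, hw0⟩ := h.nonempty
  obtain ⟨u0, hu0⟩ := hsurj w0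
  have hu0P : u0 ∈ P := by
    have h2 : u0 ^ 2 = w0 := hu0
    change u0 ^ 2 ∈ Ω
    rwa [h2]
  set U := connectedComponentIn P u0 with hU
  have hUo : IsOpen U := hPo.connectedComponentIn
  have hUc : IsPreconnected U := isPreconnected_connectedComponentIn
  have hUP : U ⊆ P := connectedComponentIn_subset _ _
  have hu0U : u0 ∈ U := mem_connectedComponentIn hu0P
  have hneg : ∀ z ∈ U, -z ∉ U := fun z hz => h.neg_notMem_of_isPreconnected h0 hUo hUc hUP hz
  -- components meeting `U` are contained in `U`
  have hmax : ∀ z ∈ P, ∀ y ∈ connectedComponentIn P z, y ∈ U → z ∈ U := by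
    intro z hz y hy hyU
    have e1 := connectedComponentIn_eq hy
    have e2 := connectedComponentIn_eq hyU
    rw [hU, e2, ← e1]
    exact mem_connectedComponentIn hz
  have hcover : ∀ w ∈ Ω, ∃ u ∈ U, u ^ 2 = w := by
    set V : Set ℂ := {z ∈ P | z ∉ U ∧ -z ∉ U} with hV
    have hnegU : IsOpen (-U) := hUo.neg
    have hVo : IsOpen V := by
      rw [isOpen_iff_mem_nhds]
      rintro z ⟨hzP, hzU, hzU'⟩
      have n1 : connectedComponentIn P z ∈ 𝓝 z :=
        hPo.connectedComponentIn.mem_nhds (mem_connectedComponentIn hzP)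
      have n2 : -connectedComponentIn P (-z) ∈ 𝓝 z :=
        hPo.connectedComponentIn.neg.mem_nhds
          (by simpa using mem_connectedComponentIn (hPneg z hzP))
      filter_upwards [n1, n2, hPo.mem_nhds hzP] with y h1 h2 h3
      exact ⟨h3, fun hy => hzU (hmax z hzP y h1 hy),
        fun hy => hzU' (hmax (-z) (hPneg z hzP) (-y) h2 hy)⟩
    change Ω ⊆ (fun z : ℂ => z ^ 2) '' U
    refine h.isPreconnected.subset_left_of_subset_union (hop _ hUo) (hop _ hVo) ?_ ?_
      ⟨w0, hw0, u0, hu0U, hu0⟩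
    · rw [Set.disjoint_left]
      rintro _ ⟨a, ha, rfl⟩ ⟨b, hb, hab⟩
      rcases sq_eq_sq_iff_eq_or_eq_neg.1 hab with rfl | rfl
      · exact hb.2.1 ha
      · exact hb.2.2 (by simpa using ha)
    · intro w hw
      obtain ⟨z, rfl⟩ := hsurj w
      by_cases h1 : z ∈ U
      · exact Or.inl ⟨z, h1, rfl⟩
      · by_cases h2 : -z ∈ U
        · exact Or.inl ⟨-z, h2, by simp⟩
        · exact Or.inr ⟨z, ⟨hw, h1, h2⟩, rfl⟩
  choose! s hsU hs2 using hcover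
  have hinv : ∀ u ∈ U, s (u ^ 2) = u := by
    intro u hu
    rcases sq_eq_sq_iff_eq_or_eq_neg.1 (hs2 _ (hUP hu)) with h1 | h1
    · exact h1
    · exact absurd (h1 ▸ hsU _ (hUP hu)) (hneg u hu)
  have himg : s '' Ω = U := by
    ext u
    constructor
    · rintro ⟨w, hw, rfl⟩
      exact hsU w hw
    · exact fun hu => ⟨u ^ 2, hUP hu, hinv u hu⟩
  have hsc : ∀ w ∈ Ω, ContinuousAt s w := by
    intro w hw
    rw [ContinuousAt, tendsto_def]
    intro N hN
    have h1 : N ∩ U ∈ 𝓝 (s w) := inter_mem hN (hUo.mem_nhds (hsU w hw))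
    have h2 := hop.image_mem_nhds h1
    simp only [hs2 w hw] at h2
    filter_upwards [h2]
    rintro _ ⟨u, hu, rfl⟩
    rw [mem_preimage, hinv u hu.2]
    exact hu.1
  refine ⟨s, fun w hw => ?_, hs2, ?_⟩
  · have hd : HasDerivAt (fun z : ℂ => z ^ 2) (2 * s w) (s w) := by
      simpa using hasDerivAt_pow 2 (s w)
    refine (HasDerivAt.of_local_left_inverse (hsc w hw) hd ?_ ?_).differentiableAt.differentiableWithinAt
    · intro h2
      have : s w = 0 := by simpa using h2
      have h3 := hs2 w hw
      rw [this] at h3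
      rw [← h3] at hw
      exact h0 (by simpa using hw)
    · filter_upwards [h.isOpen.mem_nhds hw] with y hy using hs2 y hy
  rw [himg]
  have hPball : P ⊆ Metric.ball 0 1 := by
    intro z hz
    have := h.subset_ball hz
    simp only [Metric.mem_ball, dist_zero_right, norm_pow] at this ⊢
    exact (pow_lt_one_iff_of_nonneg (norm_nonneg z) two_ne_zero).1 this
  refine ⟨hUo, hUc, hUP.trans hPball, ⟨u0, hu0U⟩, ?_⟩
  have hΩc : IsClosed (Metric.closedBall (0 : ℂ) 1 \ Ω) :=
    Metric.isClosed_closedBall.sdiff h.isOpen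
  have hD := isPreconnected_sq_preimage h.compl hΩc ⟨by simp, h0⟩
  set D := (fun z : ℂ => z ^ 2) ⁻¹' (Metric.closedBall 0 1 \ Ω) with hDdef
  have hball : ∀ z : ℂ, ‖z‖ ≤ 1 → z ∈ D ∨ z ∈ P := by
    intro z hz
    by_cases hzP : z ∈ P
    · exact Or.inr hzP
    · refine Or.inl ⟨?_, hzP⟩
      rw [mem_closedBall_zero_iff, norm_pow]
      exact pow_le_one₀ (norm_nonneg z) hz
  obtain ⟨b, hb, hbU⟩ : ∃ b ∈ closure (-U), b ∉ -U := by
    by_contra! hcon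
    have hcl : IsClosed (-U) := isClosed_of_closure_subset hcon
    have hun : -U = univ := IsClopen.eq_univ ⟨hcl, hUo.neg⟩ ⟨-u0, by simpa using hu0U⟩
    have : (1 : ℂ) ∈ -U := hun ▸ mem_univ _
    have := hPball (hUP this)
    simp at this
  have hbD : b ∈ D := by
    have hb1 : ‖b‖ ≤ 1 := by
      have : closure (-U) ⊆ Metric.closedBall 0 1 :=
        closure_minimal (fun z hz => by
          have := hPball (hUP hz)
          simp only [Metric.mem_ball, dist_zero_right, norm_neg] at this
          simpa using this.le) Metric.isClosed_closedBall
      simpa using this hb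
    refine (hball b hb1).resolve_right fun hbP => hbU ?_
    have hn : -connectedComponentIn P (-b) ∈ 𝓝 b :=
        hPo.connectedComponentIn.neg.mem_nhds
          (by simpa using mem_connectedComponentIn (hPneg b hbP))
    obtain ⟨y, hy, hyU⟩ := mem_closure_iff_nhds.1 hb _ hn
    exact hmax (-b) (hPneg b hbP) (-y) hy hyU
  have hunion : Metric.closedBall 0 1 \ U = D ∪ insert b (-U) := by
    ext z
    constructor
    · rintro ⟨hz, hzU⟩
      rcases hball z (by simpa using hz) with h1 | h1
      · exact Or.inl h1
      · refine Or.inr (Or.inr ?_)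
        rcases sq_eq_sq_iff_eq_or_eq_neg.1 (hs2 _ h1) with h2 | h2
        · exact absurd (h2 ▸ hsU _ h1) hzU
        · have h3 := hsU _ h1
          rwa [h2] at h3
    · have hDU : ∀ y ∈ D, y ∈ Metric.closedBall (0 : ℂ) 1 \ U := fun y hy => by
        refine ⟨?_, fun hyU => hy.2 (hUP hyU)⟩
        have := hy.1
        simp only [Metric.mem_closedBall, dist_zero_right, norm_pow] at this ⊢
        exact (pow_le_one_iff_of_nonneg (norm_nonneg y) two_ne_zero).1 this
      rintro (hz | rfl | hz)
      · exact hDU z hz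
      · exact hDU z hbD
      · refine ⟨?_, fun hzU => hneg z hzU hz⟩
        have := hPball (hUP hz)
        simp only [Metric.mem_ball, dist_zero_right, norm_neg] at this
        simpa using this.le
  rw [hunion]
  refine IsPreconnected.union b hbD (mem_insert _ _) hD ?_
  refine IsPreconnected.subset_closure ?_ (subset_insert _ _)
    (insert_subset hb subset_closure)
  have := hUc.image Neg.neg continuous_neg.continuousOn
  simpa using this

/-- The disc automorphism sending `a` to `0`. -/
noncomputable def discAut (a z : ℂ) : ℂ := (z - a) / (1 - (starRingEnd ℂ) a * z)

theorem discAut_den_ne_zero {a z : ℂ} (ha : ‖a‖ < 1) (hz : ‖z‖ ≤ 1) :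
    1 - (starRingEnd ℂ) a * z ≠ 0 := by
  intro h
  have h1 : ‖(starRingEnd ℂ) a * z‖ = 1 := by rw [← sub_eq_zero.1 h, norm_one]
  rw [norm_mul, Complex.norm_conj] at h1
  nlinarith [norm_nonneg a, norm_nonneg z]

theorem normSq_discAut_den_sub (a z : ℂ) :
    ‖1 - (starRingEnd ℂ) a * z‖ ^ 2 - ‖z - a‖ ^ 2 = (1 - ‖a‖ ^ 2) * (1 - ‖z‖ ^ 2) := by
  simp only [Complex.sq_norm, Complex.normSq_apply, Complex.sub_re, Complex.sub_im,
    Complex.mul_re, Complex.mul_im, Complex.conj_re, Complex.conj_im, Complex.one_re,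
    Complex.one_im]
  ring

theorem norm_discAut_lt_one {a z : ℂ} (ha : ‖a‖ < 1) (hz : ‖z‖ < 1) : ‖discAut a z‖ < 1 := by
  rw [discAut, norm_div, div_lt_one (norm_pos_iff.2 (discAut_den_ne_zero ha hz.le))]
  have := normSq_discAut_den_sub a z
  have h1 : 0 < (1 - ‖a‖ ^ 2) * (1 - ‖z‖ ^ 2) := by
    apply mul_pos <;> nlinarith [norm_nonneg a, norm_nonneg z]
  exact lt_of_pow_lt_pow_left₀ 2 (norm_nonneg _) (by linarith)

theorem norm_discAut_le_one {a z : ℂ} (ha : ‖a‖ < 1) (hz : ‖z‖ ≤ 1) : ‖discAut a z‖ ≤ 1 := by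
  rw [discAut, norm_div, div_le_one (norm_pos_iff.2 (discAut_den_ne_zero ha hz))]
  have := normSq_discAut_den_sub a z
  have h1 : 0 ≤ (1 - ‖a‖ ^ 2) * (1 - ‖z‖ ^ 2) := by
    apply mul_nonneg <;> nlinarith [norm_nonneg a, norm_nonneg z]
  exact le_of_sq_le_sq (by linarith) (norm_nonneg _)

theorem discAut_neg_discAut {a z : ℂ} (ha : ‖a‖ < 1) (hz : ‖z‖ ≤ 1) :
    discAut (-a) (discAut a z) = z := by
  have h1 := discAut_den_ne_zero ha hz
  have h2 : 1 - (starRingEnd ℂ) (-a) * discAut a z ≠ 0 :=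
    discAut_den_ne_zero (by rwa [norm_neg]) (norm_discAut_le_one ha hz)
  rw [discAut, div_eq_iff h2]
  simp only [discAut, map_neg]
  generalize (starRingEnd ℂ) a = c at h1 ⊢
  have h3 : (z - a) / (1 - c * z) * (1 - c * z) = z - a := div_mul_cancel₀ _ h1
  generalize (z - a) / (1 - c * z) = w at h3 ⊢
  linear_combination h3

theorem discAut_discAut_neg {a z : ℂ} (ha : ‖a‖ < 1) (hz : ‖z‖ ≤ 1) :
    discAut a (discAut (-a) z) = z := by
  have := discAut_neg_discAut (a := -a) (by rwa [norm_neg]) hz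
  rwa [neg_neg] at this

theorem hasDerivAt_discAut {a z : ℂ} (ha : ‖a‖ < 1) (hz : ‖z‖ ≤ 1) :
    HasDerivAt (discAut a) ((1 - (starRingEnd ℂ) a * a) / (1 - (starRingEnd ℂ) a * z) ^ 2) z := by
  have h := ((hasDerivAt_id z).sub_const a).div
    (((hasDerivAt_id z).const_mul ((starRingEnd ℂ) a)).const_sub 1) (discAut_den_ne_zero ha hz)
  refine HasDerivAt.congr_deriv h ?_
  simp only [id]
  ring

theorem continuousOn_discAut {a : ℂ} (ha : ‖a‖ < 1) :
    ContinuousOn (discAut a) (Metric.closedBall 0 1) := fun z hz =>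
  (hasDerivAt_discAut ha (by simpa using hz)).continuousAt.continuousWithinAt

theorem differentiableOn_discAut {a : ℂ} (ha : ‖a‖ < 1) :
    DifferentiableOn ℂ (discAut a) (Metric.ball 0 1) := fun z hz =>
  (hasDerivAt_discAut ha (by simpa using (Metric.ball_subset_closedBall hz))).differentiableAt.differentiableWithinAt

theorem IsDiscDomain.image_discAut {Ω : Set ℂ} (h : IsDiscDomain Ω) {a : ℂ} (ha : ‖a‖ < 1) :
    IsDiscDomain (discAut a '' Ω) := by
  have hsub : Ω ⊆ Metric.closedBall 0 1 := h.subset_ball.trans Metric.ball_subset_closedBall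
  have ha' : ‖-a‖ < 1 := by rwa [norm_neg]
  refine ⟨?_, h.isPreconnected.image _ ((continuousOn_discAut ha).mono hsub), ?_,
    h.nonempty.image _, ?_⟩
  · have : discAut a '' Ω = Metric.ball 0 1 ∩ discAut (-a) ⁻¹' Ω := by
      ext z
      constructor
      · rintro ⟨w, hw, rfl⟩
        have h1 : ‖w‖ < 1 := by simpa using h.subset_ball hw
        refine ⟨by simpa using norm_discAut_lt_one ha h1, ?_⟩
        rwa [mem_preimage, discAut_neg_discAut ha h1.le]
      · rintro ⟨hz, hz2⟩
        exact ⟨_, hz2, discAut_discAut_neg ha (by simpa using Metric.ball_subset_closedBall hz)⟩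
    rw [this]
    exact (differentiableOn_discAut ha').continuousOn.isOpen_inter_preimage Metric.isOpen_ball
      h.isOpen
  · rintro _ ⟨w, hw, rfl⟩
    simpa using norm_discAut_lt_one ha (by simpa using h.subset_ball hw)
  · have : Metric.closedBall 0 1 \ discAut a '' Ω = discAut a '' (Metric.closedBall 0 1 \ Ω) := by
      ext z
      constructor
      · rintro ⟨hz, hz2⟩
        have hz1 : ‖z‖ ≤ 1 := by simpa using hz
        refine ⟨discAut (-a) z, ⟨by simpa using norm_discAut_le_one ha' hz1, fun h1 => ?_⟩,
          discAut_discAut_neg ha hz1⟩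
        exact hz2 ⟨_, h1, discAut_discAut_neg ha hz1⟩
      · rintro ⟨w, ⟨hw, hw2⟩, rfl⟩
        have hw1 : ‖w‖ ≤ 1 := by simpa using hw
        refine ⟨by simpa using norm_discAut_le_one ha hw1, ?_⟩
        rintro ⟨v, hv, hvw⟩
        have hv1 : ‖v‖ ≤ 1 := by simpa using hsub hv
        apply hw2
        rw [← discAut_neg_discAut ha hw1, ← hvw, discAut_neg_discAut ha hv1]
        exact hv
    rw [this]
    exact h.compl.image _ ((continuousOn_discAut ha).mono sdiff_subset)

/-- One step of the Koebe expansion: a disc domain around `0` that omits the point `a` of the disc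
embeds in the disc as a disc domain, with derivative greater than `1` at `0`. -/
theorem IsDiscDomain.exists_koebe {Ω : Set ℂ} (h : IsDiscDomain Ω) (h0 : (0 : ℂ) ∈ Ω) {a : ℂ}
    (ha : ‖a‖ < 1) (haΩ : a ∉ Ω) :
    ∃ g F : ℂ → ℂ, ∃ d : ℂ, DifferentiableOn ℂ g Ω ∧ g 0 = 0 ∧ IsDiscDomain (g '' Ω) ∧
      DifferentiableOn ℂ F (Metric.ball 0 1) ∧ (∀ z ∈ Ω, F (g z) = z) ∧
      HasDerivAt F d 0 ∧ ‖d‖ * (1 + ‖a‖) = 2 * √‖a‖ := by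
  have hsub : ∀ z ∈ Ω, ‖z‖ < 1 := fun z hz => by simpa using h.subset_ball hz
  have h1 := h.image_discAut ha
  have h10 : (0 : ℂ) ∉ discAut a '' Ω := by
    rintro ⟨z, hz, hz0⟩
    have : z - a = 0 := by
      simpa [discAut, discAut_den_ne_zero ha (hsub z hz).le] using hz0
    rw [sub_eq_zero.1 this] at hz
    exact haΩ hz
  obtain ⟨s, hs, hs2, hsD⟩ := h1.exists_sqrt h10
  set b := s (discAut a 0) with hb
  have h0' : discAut a 0 = -a := by simp [discAut]
  have hb2 : b ^ 2 = -a := by rw [hb, hs2 _ ⟨0, h0, rfl⟩, h0']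
  have hbn : ‖b‖ ^ 2 = ‖a‖ := by rw [← norm_pow, hb2, norm_neg]
  have hb1 : ‖b‖ < 1 := (pow_lt_one_iff_of_nonneg (norm_nonneg _) two_ne_zero).1 (by rwa [hbn])
  have hb1' : ‖-b‖ < 1 := by rwa [norm_neg]
  have ha' : ‖-a‖ < 1 := by rwa [norm_neg]
  have hmap : MapsTo (fun w => discAut (-b) w ^ 2) (Metric.ball 0 1) (Metric.ball 0 1) := by
    intro w hw
    have := norm_discAut_lt_one hb1' (by simpa using hw : ‖w‖ < 1)
    rw [mem_ball_zero_iff, norm_pow]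
    exact pow_lt_one₀ (norm_nonneg _) this two_ne_zero
  have hsm : ∀ z ∈ Ω, ‖s (discAut a z)‖ < 1 := fun z hz => by
    simpa using hsD.subset_ball ⟨_, ⟨z, hz, rfl⟩, rfl⟩
  refine ⟨fun z => discAut b (s (discAut a z)), fun w => discAut (-a) (discAut (-b) w ^ 2),
    (1 - (starRingEnd ℂ) (-a) * (-a)) / (1 - (starRingEnd ℂ) (-a) * (discAut (-b) 0 ^ 2)) ^ 2 *
      (2 * discAut (-b) 0 * ((1 - (starRingEnd ℂ) (-b) * (-b)) / (1 - (starRingEnd ℂ) (-b) * 0) ^ 2)),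
    ?_, ?_, ?_, ?_, ?_, ?_, ?_⟩
  · refine (differentiableOn_discAut hb1).comp (hs.comp ((differentiableOn_discAut ha).mono
      h.subset_ball) (mapsTo_image _ _)) fun z hz => ?_
    simpa using hsm z hz
  · change discAut b (s (discAut a 0)) = 0
    rw [← hb, discAut, sub_self, zero_div]
  · have := hsD.image_discAut hb1
    rwa [image_image, image_image] at this
  · exact (differentiableOn_discAut ha').comp ((differentiableOn_discAut hb1').pow 2) hmap
  · intro z hz
    simp only
    rw [discAut_neg_discAut hb1 (hsm z hz).le, hs2 _ ⟨z, hz, rfl⟩,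
      discAut_neg_discAut ha (hsub z hz).le]
  · have e1 := hasDerivAt_discAut (a := -b) (z := 0) hb1' (by simp)
    have e2 := e1.pow 2
    have hm := hmap (Metric.mem_ball_self one_pos)
    have e3 := hasDerivAt_discAut (a := -a) (z := discAut (-b) 0 ^ 2) ha'
      (by simpa using (Metric.ball_subset_closedBall hm))
    have := e3.comp (0 : ℂ) e2
    simpa [Function.comp_def] using this
  · have h3 : discAut (-b) 0 = b := by simp [discAut]
    have h4 : √‖a‖ = ‖b‖ := by rw [← hbn, Real.sqrt_sq (norm_nonneg _)]
    rw [h3, hb2, h4]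
    have hc : ∀ x : ℂ, (starRingEnd ℂ) (-x) * (-x) = ((‖x‖ ^ 2 : ℝ) : ℂ) := fun x => by
      rw [mul_comm, Complex.mul_conj, Complex.normSq_eq_norm_sq, norm_neg]
    rw [hc, hc, hbn, mul_zero, sub_zero, one_pow, div_one]
    have e1 : (1 : ℂ) - ((‖a‖ ^ 2 : ℝ) : ℂ) = ((1 - ‖a‖ ^ 2 : ℝ) : ℂ) := by push_cast; ring
    have e2 : (1 : ℂ) - (‖a‖ : ℂ) = ((1 - ‖a‖ : ℝ) : ℂ) := by push_cast; ring
    have p1 : 0 < 1 - ‖a‖ ^ 2 := by nlinarith [norm_nonneg a]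
    have p2 : 0 < 1 - ‖a‖ := by linarith
    rw [e1, e2, norm_mul, norm_mul, norm_mul, norm_div, norm_pow, Complex.norm_real,
      Complex.norm_real, Real.norm_of_nonneg p1.le, Real.norm_of_nonneg p2.le]
    simp only [RCLike.norm_ofNat]
    field_simp
    ring

/-- `φ` embeds `W` holomorphically onto a disc domain, fixing `0`, with holomorphic inverse `ψ`. -/
structure IsDiscEmbedding (W : Set ℂ) (φ ψ : ℂ → ℂ) : Prop where
  diff : DifferentiableOn ℂ φ W
  zero : φ 0 = 0
  image : IsDiscDomain (φ '' W)
  diff_inv : DifferentiableOn ℂ ψ (φ '' W)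
  left_inv : ∀ z ∈ W, ψ (φ z) = z

/-- The Koebe expansion enlarges the derivative of a disc embedding which omits a point. -/
theorem IsDiscEmbedding.exists_koebe {W : Set ℂ} (hW : IsOpen W) (h0 : (0 : ℂ) ∈ W)
    {φ ψ : ℂ → ℂ} (h : IsDiscEmbedding W φ ψ) {a : ℂ} (ha : ‖a‖ < 1) (haW : a ∉ φ '' W) :
    ∃ φ' ψ', IsDiscEmbedding W φ' ψ' ∧
      ‖deriv φ 0‖ * (1 + ‖a‖) = 2 * √‖a‖ * ‖deriv φ' 0‖ := by
  obtain ⟨g, F, d, hg, hg0, hgD, hF, hFg, hd, hda⟩ :=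
    h.image.exists_koebe ⟨0, h0, h.zero⟩ ha haW
  have himg : (fun z => g (φ z)) '' W = g '' (φ '' W) := (image_image _ _ _).symm
  have hdiff : DifferentiableOn ℂ (fun z => g (φ z)) W := hg.comp h.diff (mapsTo_image _ _)
  refine ⟨fun z => g (φ z), fun w => ψ (F w), ⟨hdiff, by simp [h.zero, hg0], himg ▸ hgD, ?_, ?_⟩, ?_⟩
  · rw [himg]
    refine h.diff_inv.comp (hF.mono hgD.subset_ball) ?_
    rintro _ ⟨w, hw, rfl⟩
    rwa [hFg w hw]
  · intro z hz
    rw [hFg _ ⟨z, hz, rfl⟩, h.left_inv z hz]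
  · have h1 : HasDerivAt (fun z => g (φ z)) (deriv (fun z => g (φ z)) 0) 0 :=
      (hdiff.differentiableAt (hW.mem_nhds h0)).hasDerivAt
    have hd' : HasDerivAt F d (g (φ 0)) := by rwa [h.zero, hg0]
    have h2 := hd'.comp (0 : ℂ) h1
    have h3 : φ =ᶠ[𝓝 0] F ∘ fun z => g (φ z) := by
      filter_upwards [hW.mem_nhds h0] with z hz
      exact (hFg _ ⟨z, hz, rfl⟩).symm
    rw [(h2.congr_of_eventuallyEq h3).deriv, norm_mul, ← hda]
    ring

/-- A disc domain around `0` has disc embeddings whose images contain arbitrarily large discs. -/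
theorem IsDiscDomain.exists_isDiscEmbedding {W : Set ℂ} (hW : IsDiscDomain W) (h0 : (0 : ℂ) ∈ W)
    {r : ℝ} (hr0 : 0 < r) (hr1 : r < 1) :
    ∃ φ ψ, IsDiscEmbedding W φ ψ ∧ Metric.ball 0 r ⊆ φ '' W := by
  by_contra! hcon
  set S : Set ℝ := {m | ∃ φ ψ, IsDiscEmbedding W φ ψ ∧ m = ‖deriv φ 0‖} with hS
  obtain ⟨ρ, hρ, hρW⟩ := Metric.isOpen_iff.1 hW.isOpen 0 h0
  have hbdd : BddAbove S := by
    refine ⟨1 / ρ, ?_⟩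
    rintro _ ⟨φ, ψ, h, rfl⟩
    refine Complex.norm_deriv_le_div_of_mapsTo_ball (h.diff.mono hρW) ?_ hρ
    intro z hz
    rw [h.zero]
    exact Metric.ball_subset_closedBall (h.image.subset_ball ⟨z, hρW hz, rfl⟩)
  have h1S : (1 : ℝ) ∈ S :=
    ⟨id, id, ⟨differentiableOn_id, rfl, by simpa using hW, differentiableOn_id, fun _ _ => rfl⟩,
      by simp⟩
  set k : ℝ := (1 + r) / (2 * √r) with hk
  have hsr : 0 < √r := Real.sqrt_pos.2 hr0
  have hsr2 : √r ^ 2 = r := Real.sq_sqrt hr0.le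
  have hsr1 : √r < 1 := by nlinarith
  have hk1 : 1 < k := by
    rw [hk, one_lt_div (by positivity)]
    nlinarith [sq_pos_of_pos (sub_pos.2 hsr1)]
  have hstep : ∀ m ∈ S, k * m ≤ sSup S := by
    rintro _ ⟨φ, ψ, h, rfl⟩
    obtain ⟨a, har, haW⟩ := not_subset.1 (hcon φ ψ h)
    have har' : ‖a‖ < r := by simpa using har
    have ha0 : 0 < ‖a‖ := norm_pos_iff.2 fun ha => haW (ha ▸ ⟨0, h0, h.zero⟩)
    obtain ⟨φ', ψ', h', he⟩ := h.exists_koebe hW.isOpen h0 (har'.trans hr1) haW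
    refine le_trans ?_ (le_csSup hbdd ⟨φ', ψ', h', rfl⟩)
    have hx : 0 < √‖a‖ := Real.sqrt_pos.2 ha0
    have hx2 : √‖a‖ ^ 2 = ‖a‖ := Real.sq_sqrt ha0.le
    have hxr : √‖a‖ ≤ √r := Real.sqrt_le_sqrt har'.le
    have hkey : k * (2 * √‖a‖) ≤ 1 + ‖a‖ := by
      rw [hk, div_mul_eq_mul_div, div_le_iff₀ (by positivity)]
      nlinarith [mul_nonneg (sub_nonneg.2 hxr) (sub_nonneg.2
        (mul_le_one₀ (hxr.trans hsr1.le) hsr.le hsr1.le : √‖a‖ * √r ≤ 1))]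
    have := mul_le_mul_of_nonneg_left hkey (norm_nonneg (deriv φ 0))
    rw [he] at this
    have h2 : (2 * √‖a‖) * (k * ‖deriv φ 0‖) ≤ (2 * √‖a‖) * ‖deriv φ' 0‖ := by linarith
    exact le_of_mul_le_mul_left h2 (by positivity)
  have hM : sSup S ≤ sSup S / k := csSup_le ⟨1, h1S⟩ fun m hm => by
    rw [le_div_iff₀ (by linarith), mul_comm]
    exact hstep m hm
  have hM1 : 1 ≤ sSup S := le_csSup hbdd h1S
  rw [le_div_iff₀ (by linarith)] at hM
  nlinarith

/-- Montel's theorem along an ultrafilter. -/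
theorem exists_tendstoLocallyUniformlyOn_ultrafilter {ι : Type*} {U : Set ℂ} {F : ι → ℂ → ℂ}
    (l : Ultrafilter ι)
    (hF : ∀ x ∈ U, ∃ δ > 0, ∀ᶠ n in (l : Filter ι), DifferentiableOn ℂ (F n) (Metric.ball x δ) ∧
      ∀ z ∈ Metric.ball x δ, ‖F n z‖ ≤ 1) (hU : IsOpen U) :
    ∃ f : ℂ → ℂ, TendstoLocallyUniformlyOn F f l U ∧ DifferentiableOn ℂ f U := by
  have hlim : ∀ x, ∃ y, x ∈ U → Tendsto (fun n => F n x) l (𝓝 y) := by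
    intro x
    by_cases hx : x ∈ U
    · obtain ⟨δ, hδ, h⟩ := hF x hx
      obtain ⟨y, -, hy⟩ := (isCompact_closedBall (0 : ℂ) 1).ultrafilter_le_nhds
        (l.map fun n => F n x) (by
          rw [le_principal_iff, Ultrafilter.mem_coe, Ultrafilter.mem_map]
          filter_upwards [h] with n hn
          simpa using hn.2 x (Metric.mem_ball_self hδ))
      exact ⟨y, fun _ => hy⟩
    · exact ⟨0, fun h => absurd h hx⟩
  choose f hf using hlim
  have hunif : TendstoLocallyUniformlyOn F f l U := by
    rw [Metric.tendstoLocallyUniformlyOn_iff]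
    intro ε hε x hx
    obtain ⟨δ, hδ, h⟩ := hF x hx
    have hlip : ∀ᶠ n in (l : Filter ι), ∀ y ∈ Metric.ball x δ,
        dist (F n y) (F n x) ≤ 2 / δ * dist y x := by
      filter_upwards [h] with n hn y hy
      refine Complex.dist_le_div_mul_dist_of_mapsTo_ball hn.1 (fun z hz => ?_) hy
      rw [mem_closedBall_iff_norm]
      have h1 := hn.2 z hz
      have h2 := hn.2 x (Metric.mem_ball_self hδ)
      exact (norm_sub_le _ _).trans (by linarith)
    have hlim : ∀ y ∈ Metric.ball x δ ∩ U, dist (f y) (f x) ≤ 2 / δ * dist y x := by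
      intro y hy
      refine le_of_tendsto ((hf y hy.2).dist (hf x hx)) ?_
      filter_upwards [hlip] with n hn using hn y hy.1
    refine ⟨Metric.ball x (min δ (ε * δ / 8)) ∩ U, ?_, ?_⟩
    · exact mem_nhdsWithin_of_mem_nhds (inter_mem (Metric.ball_mem_nhds x (by positivity))
        (hU.mem_nhds hx))
    · filter_upwards [hlip, Metric.tendsto_nhds.1 (hf x hx) (ε / 2) (by positivity)] with n hn hn'
      rintro y ⟨hy, hyU⟩
      rw [Metric.mem_ball, lt_min_iff] at hy
      have h1 := hn y hy.1
      have h2 := hlim y ⟨hy.1, hyU⟩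
      have h3 : 2 / δ * dist y x < ε / 4 := by
        rw [div_mul_eq_mul_div, div_lt_iff₀ hδ]
        linarith [hy.2]
      have h4 := dist_triangle4 (f y) (f x) (F n x) (F n y)
      rw [dist_comm (f x) (F n x), dist_comm (F n x) (F n y)] at h4
      linarith
  refine ⟨f, hunif, fun x hx => ?_⟩
  obtain ⟨δ, hδ, h⟩ := hF x hx
  have hsub := hunif.mono (inter_subset_right : Metric.ball x δ ∩ U ⊆ U)
  have hd := hsub.differentiableOn (h.mono fun n hn => hn.1.mono inter_subset_left)
    (Metric.isOpen_ball.inter hU)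
  exact (hd.differentiableAt (inter_mem (Metric.ball_mem_nhds x hδ)
    (hU.mem_nhds hx))).differentiableWithinAt

/-- A form of Hurwitz's theorem: a nonconstant locally uniform limit of holomorphic functions that
eventually miss the value `b` near `w` does not take the value `b` at `w`. -/
theorem TendstoLocallyUniformlyOn.ne_of_eventually_ne {ι : Type*} {l : Filter ι} [l.NeBot]
    {U : Set ℂ} {F : ι → ℂ → ℂ} {f : ℂ → ℂ} (hunif : TendstoLocallyUniformlyOn F f l U)
    (hf : DifferentiableOn ℂ f U) (hU : IsOpen U) (hUc : IsPreconnected U) {w v b : ℂ}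
    (hw : w ∈ U) (hv : v ∈ U) (hfv : f v ≠ b) {δ : ℝ} (hδ : 0 < δ)
    (hF : ∀ᶠ n in l, DifferentiableOn ℂ (F n) (Metric.ball w δ) ∧
      ∀ z ∈ Metric.ball w δ, F n z ≠ b) : f w ≠ b := by
  intro hfw
  have hg : AnalyticOnNhd ℂ (fun z => f z - b) U :=
    (hf.sub_const b).analyticOnNhd hU
  have hev : ∀ᶠ z in 𝓝[≠] w, f z - b ≠ 0 := by
    rcases (hg w hw).eventually_eq_zero_or_eventually_ne_zero with h | h
    · exact absurd (hg.eqOn_zero_of_preconnected_of_eventuallyEq_zero hUc hw h hv)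
        (sub_ne_zero.2 hfv)
    · exact h
  obtain ⟨ρ, hρ, hρs⟩ := Metric.mem_nhdsWithin_iff.1 hev
  obtain ⟨σ, hσ, hσs⟩ := Metric.isOpen_iff.1 hU w hw
  obtain ⟨ε, hε, hε'⟩ : ∃ ε > 0, ε < min δ (min ρ σ) :=
    ⟨min δ (min ρ σ) / 2, by positivity, half_lt_self (by positivity)⟩
  rw [lt_min_iff, lt_min_iff] at hε'
  have hcU : Metric.closedBall w ε ⊆ U :=
    (Metric.closedBall_subset_ball hε'.2.2).trans hσs
  have hcδ : Metric.closedBall w ε ⊆ Metric.ball w δ := Metric.closedBall_subset_ball hε'.1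
  obtain ⟨m, hm, hmin⟩ : ∃ m > 0, ∀ z ∈ Metric.sphere w ε, m ≤ ‖f z - b‖ := by
    have hc : ContinuousOn (fun z => ‖f z - b‖) (Metric.sphere w ε) :=
      ((hf.continuousOn.mono (Metric.sphere_subset_closedBall.trans hcU)).sub
        continuousOn_const).norm
    obtain ⟨z, hz, hzm⟩ := (isCompact_sphere w ε).exists_isMinOn
      (NormedSpace.sphere_nonempty.2 hε.le) hc
    refine ⟨‖f z - b‖, norm_pos_iff.2 (hρs ⟨?_, ?_⟩), fun y hy => hzm hy⟩
    · rw [Metric.mem_ball, Metric.mem_sphere.1 hz]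
      exact hε'.2.1
    · rintro rfl
      simp [hε.ne] at hz
  have hU1 := (tendstoLocallyUniformlyOn_iff_forall_isCompact hU).1 hunif _ hcU
    (isCompact_closedBall w ε)
  have := Metric.tendstoUniformlyOn_iff.1 hU1 (m / 2) (by positivity)
  obtain ⟨n, ⟨hn1, hn2⟩, hn3⟩ := (hF.and this).exists
  have hne : ∀ z ∈ Metric.closedBall w ε, F n z - b ≠ 0 := fun z hz =>
    sub_ne_zero.2 (hn2 z (hcδ hz))
  have hdc : DiffContOnCl ℂ (fun z => (F n z - b)⁻¹) (Metric.ball w ε) := by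
    apply DifferentiableOn.diffContOnCl
    rw [closure_ball w hε.ne']
    exact ((hn1.mono hcδ).sub_const b).inv hne
  have hmax := Complex.norm_le_of_forall_mem_frontier_norm_le Metric.isBounded_ball hdc
    (C := (m / 2)⁻¹) (fun z hz => by
      rw [frontier_ball w hε.ne'] at hz
      rw [norm_inv]
      refine inv_anti₀ (by positivity) ?_
      have h1 := hmin z hz
      have h2 := hn3 z (Metric.sphere_subset_closedBall hz)
      rw [dist_eq_norm] at h2
      have h3 := norm_sub_norm_le (f z - b) (F n z - b)
      rw [sub_sub_sub_cancel_right] at h3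
      linarith) (subset_closure (Metric.mem_ball_self hε))
  have h1 := hn3 w (Metric.mem_closedBall_self hε.le)
  rw [hfw, dist_comm, dist_eq_norm] at h1
  rw [norm_inv] at hmax
  have h2 := norm_pos_iff.2 (hne w (Metric.mem_closedBall_self hε.le))
  have := (inv_le_inv₀ h2 (by positivity)).1 hmax
  linarith

/-- The Riemann mapping theorem for disc domains containing `0`. -/
theorem IsDiscDomain.exists_riemannMap {W : Set ℂ} (hW : IsDiscDomain W) (h0 : (0 : ℂ) ∈ W) :
    ∃ φ ψ : ℂ → ℂ, DifferentiableOn ℂ φ W ∧ DifferentiableOn ℂ ψ (Metric.ball 0 1) ∧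
      MapsTo φ W (Metric.ball 0 1) ∧ MapsTo ψ (Metric.ball 0 1) W ∧ φ 0 = 0 ∧
      (∀ z ∈ W, ψ (φ z) = z) ∧ ∀ w ∈ Metric.ball 0 1, φ (ψ w) = w := by
  have hr : ∀ n : ℕ, 0 < 1 - 1 / ((n : ℝ) + 2) ∧ 1 - 1 / ((n : ℝ) + 2) < 1 := fun n => by
    have h1 : 1 / ((n : ℝ) + 2) < 1 := by
      rw [div_lt_one (by positivity)]
      linarith [Nat.cast_nonneg (α := ℝ) n]
    have h2 : 0 < 1 / ((n : ℝ) + 2) := by positivity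
    constructor <;> linarith
  choose Φ Ψ hE hball using fun n : ℕ => hW.exists_isDiscEmbedding h0 (hr n).1 (hr n).2
  set l := hyperfilter ℕ with hl
  have hlt : (l : Filter ℕ) ≤ atTop := by
    rw [← Nat.cofinite_eq_atTop]
    exact hyperfilter_le_cofinite
  have hlarge : ∀ r < 1, ∀ᶠ n in (l : Filter ℕ), Metric.ball (0 : ℂ) r ⊆ Φ n '' W := by
    intro r hr1
    have ht : Tendsto (fun n : ℕ => 1 - 1 / ((n : ℝ) + 2)) atTop (𝓝 1) := by
      have : Tendsto (fun n : ℕ => 1 / ((n : ℝ) + 2)) atTop (𝓝 0) :=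
        tendsto_const_nhds.div_atTop
          (tendsto_natCast_atTop_atTop.atTop_add tendsto_const_nhds)
      simpa using this.const_sub 1
    filter_upwards [(ht.mono_left hlt).eventually_const_lt hr1] with n hn
    exact (Metric.ball_subset_ball hn.le).trans (hball n)
  have hlocal : ∀ w ∈ Metric.ball (0 : ℂ) 1, ∃ δ > 0, ∀ᶠ n in (l : Filter ℕ),
      Metric.ball w δ ⊆ Φ n '' W := by
    intro w hw
    have hw1 : ‖w‖ < 1 := by simpa using hw
    refine ⟨(1 - ‖w‖) / 2, by linarith, ?_⟩
    filter_upwards [hlarge ((1 + ‖w‖) / 2) (by linarith)] with n hn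
    refine (Metric.ball_subset_ball' ?_).trans hn
    rw [dist_zero_right]
    linarith
  have hΨW : ∀ n, ∀ w ∈ Φ n '' W, Ψ n w ∈ W ∧ Φ n (Ψ n w) = w := by
    rintro n _ ⟨z, hz, rfl⟩
    rw [(hE n).left_inv z hz]
    exact ⟨hz, rfl⟩
  obtain ⟨φ, hφu, hφ⟩ := exists_tendstoLocallyUniformlyOn_ultrafilter (F := Φ) l (U := W)
    (fun x hx => by
      obtain ⟨δ, hδ, hδW⟩ := Metric.isOpen_iff.1 hW.isOpen x hx
      refine ⟨δ, hδ, Eventually.of_forall fun n => ⟨(hE n).diff.mono hδW, fun z hz => ?_⟩⟩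
      exact le_of_lt (by simpa using (hE n).image.subset_ball ⟨z, hδW hz, rfl⟩)) hW.isOpen
  obtain ⟨ψ, hψu, hψ⟩ := exists_tendstoLocallyUniformlyOn_ultrafilter (F := Ψ) l
    (U := Metric.ball 0 1)
    (fun x hx => by
      obtain ⟨δ, hδ, hev⟩ := hlocal x hx
      refine ⟨δ, hδ, hev.mono fun n hn => ⟨(hE n).diff_inv.mono hn, fun z hz => ?_⟩⟩
      exact le_of_lt (by simpa using hW.subset_ball (hΨW n z (hn hz)).1)) Metric.isOpen_ball
  have hφt : ∀ z ∈ W, Tendsto (fun n => Φ n z) l (𝓝 (φ z)) := fun z hz => hφu.tendsto_at hz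
  have hψt : ∀ z ∈ Metric.ball (0 : ℂ) 1, Tendsto (fun n => Ψ n z) l (𝓝 (ψ z)) :=
    fun z hz => hψu.tendsto_at hz
  have hφ0 : φ 0 = 0 := by
    refine tendsto_nhds_unique (hφt 0 h0) ?_
    simp only [(hE _).zero]
    exact tendsto_const_nhds
  have hφle : ∀ z ∈ W, ‖φ z‖ ≤ 1 := fun z hz => by
    refine le_of_tendsto (hφt z hz).norm (Eventually.of_forall fun n => le_of_lt ?_)
    simpa using (hE n).image.subset_ball ⟨z, hz, rfl⟩
  have hφlt : MapsTo φ W (Metric.ball 0 1) := by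
    intro z hz
    rw [mem_ball_zero_iff]
    refine lt_of_le_of_ne (hφle z hz) fun h1 => ?_
    have hmax : IsMaxOn (norm ∘ φ) W z := fun y hy => by
      change ‖φ y‖ ≤ ‖φ z‖
      rw [h1]
      exact hφle y hy
    have := Complex.eqOn_of_isPreconnected_of_isMaxOn_norm hW.isPreconnected hW.isOpen hφ hz hmax h0
    rw [hφ0, Function.const_apply] at this
    rw [← this] at h1
    simp at h1
  have hψφ : ∀ z ∈ W, ψ (φ z) = z := by
    intro z hz
    have ht := hψu.tendsto_comp (hψ.continuousOn _ (hφlt hz)) (hφlt hz)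
      (tendsto_nhdsWithin_of_tendsto_nhds_of_eventually_within _ (hφt z hz)
        (Eventually.of_forall fun n => (hE n).image.subset_ball ⟨z, hz, rfl⟩))
    refine tendsto_nhds_unique ht ?_
    simp only [fun n => (hE n).left_inv z hz]
    exact tendsto_const_nhds
  have hψW : MapsTo ψ (Metric.ball 0 1) W := by
    intro w hw
    by_contra hb
    obtain ⟨δ, hδ, hev⟩ := hlocal w hw
    refine hψu.ne_of_eventually_ne hψ Metric.isOpen_ball
      (convex_ball (0 : ℂ) 1).isPreconnected hw (hφlt h0)
      (b := ψ w) ?_ hδ ?_ rfl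
    · rw [hψφ 0 h0]
      rintro h
      exact hb (h ▸ h0)
    · filter_upwards [hev] with n hn
      refine ⟨(hE n).diff_inv.mono hn, fun z hz h => hb ?_⟩
      rw [← h]
      exact (hΨW n z (hn hz)).1
  refine ⟨φ, ψ, hφ, hψ, hφlt, hψW, hφ0, hψφ, fun w hw => ?_⟩
  obtain ⟨δ, hδ, hev⟩ := hlocal w hw
  have hev' : ∀ᶠ n in (l : Filter ℕ), w ∈ Φ n '' W :=
    hev.mono fun n hn => hn (Metric.mem_ball_self hδ)
  have ht := hφu.tendsto_comp (hφ.continuousOn _ (hψW hw)) (hψW hw)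
    (tendsto_nhdsWithin_of_tendsto_nhds_of_eventually_within _ (hψt w hw)
      (hev'.mono fun n hn => (hΨW n w hn).1))
  refine tendsto_nhds_unique ht (tendsto_const_nhds.congr' ?_)
  filter_upwards [hev'] with n hn using (hΨW n w hn).2.symm

/-- A nonvanishing continuous factor of a holomorphic injection fixing `0`. -/
theorem exists_continuousOn_factor {W W' : Set ℂ} (hW : IsOpen W) (h0 : (0 : ℂ) ∈ W)
    {φ ψ : ℂ → ℂ} (hφ : DifferentiableOn ℂ φ W) (hφ0 : φ 0 = 0)
    (hW' : IsOpen W') (hφW : MapsTo φ W W') (hψ : DifferentiableOn ℂ ψ W')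
    (hψφ : ∀ z ∈ W, ψ (φ z) = z) :
    ∃ χ : ℂ → ℂ, ContinuousOn χ W ∧ (∀ z ∈ W, χ z ≠ 0) ∧ ∀ z ∈ W, φ z = z * χ z := by
  have hmul : ∀ z, φ z = z * dslope φ 0 z := fun z => by
    have := sub_smul_dslope φ 0 z
    rw [hφ0, sub_zero, sub_zero, smul_eq_mul] at this
    exact this.symm
  have hd := hφ.differentiableAt (hW.mem_nhds h0)
  refine ⟨dslope φ 0, (continuousOn_dslope (hW.mem_nhds h0)).2 ⟨hφ.continuousOn, hd⟩, ?_,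
    fun z _ => hmul z⟩
  intro z hz h
  by_cases hz0 : z = 0
  · subst hz0
    rw [dslope_same] at h
    have h1 := hd.hasDerivAt
    have h2 := (hψ.differentiableAt (hW'.mem_nhds (hφW h0))).hasDerivAt.comp (0 : ℂ) h1
    have h3 : id =ᶠ[𝓝 0] ψ ∘ φ := by
      filter_upwards [hW.mem_nhds h0] with z hz using (hψφ z hz).symm
    have h4 := (h2.congr_of_eventuallyEq h3).unique (hasDerivAt_id (0 : ℂ))
    rw [h, mul_zero] at h4
    exact zero_ne_one h4
  · have h1 := hmul z
    rw [h, mul_zero] at h1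
    have h2 := hψφ z hz
    rw [h1, ← hφ0, hψφ 0 h0] at h2
    exact hz0 h2.symm

/-- Polar coordinates. -/
def polarMap (p : Ann) : ℂ := p.2 * (AddCircle.toCircle p.1 : ℂ)

/-- The argument of a nonzero complex number, as a point of `ℝ/ℤ`. -/
def argCirc (z : ℂ) : Circ :=
  (AddCircle.homeomorphCircle one_ne_zero).symm (AddCircle.homeomorphCircle' (z.arg : Real.Angle))

theorem norm_mul_toCircle_argCirc (z : ℂ) : (‖z‖ : ℂ) * (AddCircle.toCircle (argCirc z) : ℂ) = z := by
  rw [argCirc, ← AddCircle.homeomorphCircle_apply one_ne_zero, Homeomorph.apply_symm_apply]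
  exact Complex.norm_mul_exp_arg_mul_I z

theorem continuousOn_argCirc : ContinuousOn argCirc {0}ᶜ := by
  refine (Homeomorph.continuous _).comp_continuousOn ((Homeomorph.continuous _).comp_continuousOn ?_)
  exact fun z hz => (Complex.continuousAt_arg_coe_angle hz).continuousWithinAt

theorem continuous_polarMap : Continuous polarMap :=
  (Complex.continuous_ofReal.comp continuous_snd).mul
    (continuous_subtype_val.comp (AddCircle.continuous_toCircle.comp continuous_fst))

theorem norm_polarMap {p : Ann} (hp : 0 ≤ p.2) : ‖polarMap p‖ = p.2 := by
  rw [polarMap, norm_mul, Circle.norm_coe, mul_one, Complex.norm_real, Real.norm_of_nonneg hp]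

theorem polarMap_argCirc (z : ℂ) : polarMap (argCirc z, ‖z‖) = z := norm_mul_toCircle_argCirc z

theorem polarMap_injOn {p p' : Ann} (hp : 0 < p.2) (hp' : 0 ≤ p'.2)
    (h : polarMap p = polarMap p') : p = p' := by
  have h2 : p.2 = p'.2 := by rw [← norm_polarMap hp.le, h, norm_polarMap hp']
  have h3 : (p.2 : ℂ) ≠ 0 := by exact_mod_cast hp.ne'
  rw [polarMap, polarMap, ← h2] at h
  exact Prod.ext (AddCircle.injective_toCircle one_ne_zero
    (Circle.ext (mul_left_cancel₀ h3 h))) h2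

theorem polarMap_mul (p : Ann) (c : ℂ) :
    polarMap (p.1 + argCirc c, p.2 * ‖c‖) = polarMap p * c := by
  conv_rhs => rw [← norm_mul_toCircle_argCirc c]
  simp only [polarMap, AddCircle.toCircle_add, Circle.coe_mul, Complex.ofReal_mul]
  ring

/-- A homeomorphism between plane domains of the form `z ↦ z * χ z` with `χ` continuous and
nonvanishing lifts to polar coordinates. -/
theorem nonempty_homeomorph_polar {W₁ W₂ : Set ℂ} {φ ψ χ : ℂ → ℂ} (hφ : MapsTo φ W₁ W₂)
    (hψ : MapsTo ψ W₂ W₁) (hψc : ContinuousOn ψ W₂)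
    (hψφ : ∀ z ∈ W₁, ψ (φ z) = z) (hφψ : ∀ w ∈ W₂, φ (ψ w) = w)
    (hχc : ContinuousOn χ W₁) (hχ0 : ∀ z ∈ W₁, χ z ≠ 0) (hφχ : ∀ z ∈ W₁, φ z = z * χ z) :
    Nonempty (({p : Ann | 0 ≤ p.2 ∧ polarMap p ∈ W₁} : Set Ann) ≃ₜ
      ({p : Ann | 0 ≤ p.2 ∧ polarMap p ∈ W₂} : Set Ann)) := by
  set V₁ : Set Ann := {p : Ann | 0 ≤ p.2 ∧ polarMap p ∈ W₁} with hV₁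
  set V₂ : Set Ann := {p : Ann | 0 ≤ p.2 ∧ polarMap p ∈ W₂} with hV₂
  let H : Ann → Ann := fun p => (p.1 + argCirc (χ (polarMap p)), p.2 * ‖χ (polarMap p)‖)
  let G : Ann → Ann := fun p =>
    (p.1 - argCirc (χ (ψ (polarMap p))), p.2 / ‖χ (ψ (polarMap p))‖)
  have hq₁ : MapsTo polarMap V₁ W₁ := fun p hp => hp.2
  have hq₂ : MapsTo polarMap V₂ W₂ := fun p hp => hp.2
  have hHq : ∀ p ∈ V₁, polarMap (H p) = φ (polarMap p) := fun p hp => by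
    rw [hφχ _ hp.2]
    exact polarMap_mul p _
  have hGH : ∀ p ∈ V₁, G (H p) = p := fun p hp => by
    simp only [G, hHq p hp, hψφ _ hp.2]
    refine Prod.ext (add_sub_cancel_right _ _) ?_
    exact mul_div_cancel_right₀ _ (norm_ne_zero_iff.2 (hχ0 _ hp.2))
  have hGq : ∀ p ∈ V₂, polarMap (G p) = ψ (polarMap p) := fun p hp => by
    have hne := hχ0 _ (hψ hp.2)
    have h1 := polarMap_mul (G p) (χ (ψ (polarMap p)))
    have h2 : ((G p).1 + argCirc (χ (ψ (polarMap p))), (G p).2 * ‖χ (ψ (polarMap p))‖) = p :=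
      Prod.ext (sub_add_cancel _ _) (div_mul_cancel₀ _ (norm_ne_zero_iff.2 hne))
    rw [h2] at h1
    have h3 := hφχ _ (hψ hp.2)
    rw [hφψ _ hp.2] at h3
    exact mul_right_cancel₀ hne (h1.symm.trans h3)
  have hHG : ∀ p ∈ V₂, H (G p) = p := fun p hp => by
    simp only [H, hGq p hp]
    exact Prod.ext (sub_add_cancel _ _)
      (div_mul_cancel₀ _ (norm_ne_zero_iff.2 (hχ0 _ (hψ hp.2))))
  have hH : MapsTo H V₁ V₂ := fun p hp =>
    ⟨mul_nonneg hp.1 (norm_nonneg _), by rw [hHq p hp]; exact hφ hp.2⟩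
  have hG : MapsTo G V₂ V₁ := fun p hp =>
    ⟨div_nonneg hp.1 (norm_nonneg _), by rw [hGq p hp]; exact hψ hp.2⟩
  have hc₁ : ContinuousOn (fun p => χ (polarMap p)) V₁ :=
    hχc.comp continuous_polarMap.continuousOn hq₁
  have hc₂ : ContinuousOn (fun p => χ (ψ (polarMap p))) V₂ :=
    hχc.comp (hψc.comp continuous_polarMap.continuousOn hq₂) (hψ.comp hq₂)
  have hHc : ContinuousOn H V₁ :=
    (continuous_fst.continuousOn.add (continuousOn_argCirc.comp hc₁ fun p hp => hχ0 _ hp.2)).prodMk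
      (continuous_snd.continuousOn.mul hc₁.norm)
  have hGc : ContinuousOn G V₂ :=
    (continuous_fst.continuousOn.sub
      (continuousOn_argCirc.comp hc₂ fun p hp => hχ0 _ (hψ hp.2))).prodMk
      (continuous_snd.continuousOn.div hc₂.norm fun p hp => norm_ne_zero_iff.2 (hχ0 _ (hψ hp.2)))
  exact ⟨{
    toFun := hH.restrict
    invFun := hG.restrict
    left_inv := fun p => Subtype.ext (hGH p p.2)
    right_inv := fun p => Subtype.ext (hHG p p.2)
    continuous_toFun := hHc.mapsToRestrict hH
    continuous_invFun := hGc.mapsToRestrict hG }⟩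

theorem isCompact_stdA : IsCompact stdA := by
  have : stdA = univ ×ˢ Icc (0 : ℝ) 1 := by
    ext p
    simp [stdA]
  rw [this]
  exact isCompact_univ.prod isCompact_Icc

/-- A connected relatively open subset of the closed annulus with connected complement, which
contains the lower boundary and misses the upper one, is a half-open annulus. -/
theorem nonempty_homeomorph_halfOpenAnn {V : Set Ann} (hV : V ⊆ stdA) (hlow : bdLow ⊆ V)
    (hhigh : Disjoint V bdHigh) (hcl : IsClosed (stdA \ V)) (hVc : IsPreconnected V)
    (hcc : IsPreconnected (stdA \ V)) : Nonempty (V ≃ₜ halfOpenAnn) := by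
  have hpos : ∀ p ∈ stdA \ V, 0 < p.2 := fun p hp =>
    lt_of_le_of_ne hp.1.1 fun h => hp.2 (hlow h.symm)
  have hlt : ∀ p ∈ V, p.2 < 1 := fun p hp =>
    lt_of_le_of_ne (hV hp).2 fun h => Set.disjoint_left.1 hhigh hp h
  have hdisj : ∀ p ∈ V, ∀ p' ∈ stdA \ V, polarMap p ≠ polarMap p' := fun p hp p' hp' h => by
    rw [polarMap_injOn (hpos p' hp') (hV hp).1 h.symm] at hp'
    exact hp'.2 hp
  have hmem : ∀ z : ℂ, ‖z‖ ≤ 1 → z ∈ polarMap '' V ∨ z ∈ polarMap '' (stdA \ V) := fun z hz => by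
    have h1 : (argCirc z, ‖z‖) ∈ stdA := ⟨norm_nonneg z, hz⟩
    by_cases h2 : (argCirc z, ‖z‖) ∈ V
    · exact Or.inl ⟨_, h2, polarMap_argCirc z⟩
    · exact Or.inr ⟨_, ⟨h1, h2⟩, polarMap_argCirc z⟩
  have h0V : ((0 : Circ), (0 : ℝ)) ∈ V := hlow rfl
  have h0 : (0 : ℂ) ∈ polarMap '' V := ⟨_, h0V, by simp [polarMap]⟩
  have hW : IsDiscDomain (polarMap '' V) := by
    have hsub : polarMap '' V ⊆ Metric.ball 0 1 := by
      rintro _ ⟨p, hp, rfl⟩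
      rw [mem_ball_zero_iff, norm_polarMap (hV hp).1]
      exact hlt p hp
    refine ⟨?_, hVc.image _ continuous_polarMap.continuousOn, hsub, ⟨0, h0⟩, ?_⟩
    · have : polarMap '' V = Metric.ball 0 1 \ polarMap '' (stdA \ V) := by
        ext z
        constructor
        · rintro ⟨p, hp, rfl⟩
          refine ⟨hsub ⟨p, hp, rfl⟩, ?_⟩
          rintro ⟨p', hp', h⟩
          exact hdisj p hp p' hp' h.symm
        · rintro ⟨hz, hz2⟩
          exact (hmem z (le_of_lt (by simpa using hz))).resolve_right hz2
      rw [this]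
      exact Metric.isOpen_ball.sdiff (((isCompact_stdA.of_isClosed_subset hcl
        sdiff_subset).image continuous_polarMap).isClosed)
    · have : Metric.closedBall 0 1 \ polarMap '' V = polarMap '' (stdA \ V) := by
        ext z
        constructor
        · rintro ⟨hz, hz2⟩
          exact (hmem z (by simpa using hz)).resolve_left hz2
        · rintro ⟨p, hp, rfl⟩
          refine ⟨?_, ?_⟩
          · rw [mem_closedBall_zero_iff, norm_polarMap hp.1.1]
            exact hp.1.2
          · rintro ⟨p', hp', h⟩
            exact hdisj p' hp' p hp h
      rw [this]
      exact hcc.image _ continuous_polarMap.continuousOn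
  obtain ⟨φ, ψ, hφ, hψ, hφW, hψW, hφ0, hψφ, hφψ⟩ := hW.exists_riemannMap h0
  obtain ⟨χ, hχ, hχ0, hφχ⟩ :=
    exists_continuousOn_factor hW.isOpen h0 hφ hφ0 Metric.isOpen_ball hφW hψ hψφ
  have e₁ : {p : Ann | 0 ≤ p.2 ∧ polarMap p ∈ polarMap '' V} = V := by
    ext p
    constructor
    · rintro ⟨hp, p', hp', h⟩
      rcases hp.eq_or_lt with h0 | h0
      · exact hlow h0.symm
      · rwa [polarMap_injOn h0 (hV hp').1 h.symm]
    · exact fun hp => ⟨(hV hp).1, p, hp, rfl⟩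
  have e₂ : {p : Ann | 0 ≤ p.2 ∧ polarMap p ∈ Metric.ball (0 : ℂ) 1} = halfOpenAnn := by
    ext p
    refine and_congr_right fun hp => ?_
    rw [mem_ball_zero_iff, norm_polarMap hp]
  have := nonempty_homeomorph_polar hφW hψW hψ.continuousOn hψφ hφψ hχ hχ0 hφχ
  rwa [e₁, e₂] at this

theorem closure_connectedComponentIn_inter_subset {X : Type*} [TopologicalSpace X] {W : Set X}
    {x : X} (hx : x ∈ W) : closure (connectedComponentIn W x) ∩ W ⊆ connectedComponentIn W x := by
  refine IsPreconnected.subset_connectedComponentIn ?_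
    ⟨subset_closure (mem_connectedComponentIn hx), hx⟩ inter_subset_right
  exact isPreconnected_connectedComponentIn.subset_closure
    (subset_inter subset_closure (connectedComponentIn_subset _ _)) inter_subset_left

namespace TwoComponents

variable {W Km Kp : Set Ann}

theorem symm (h : TwoComponents W Km Kp) : TwoComponents W Kp Km :=
  ⟨h.1.symm, by rw [union_comm, h.2.1], h.2.2.2.1, h.2.2.1, fun x hx => (h.2.2.2.2 x hx).symm⟩

theorem isPreconnected (h : TwoComponents W Km Kp) : IsPreconnected Km := by
  obtain ⟨-, -, ⟨x, -, rfl⟩, -⟩ := h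
  exact isPreconnected_connectedComponentIn

theorem closure_inter_subset (h : TwoComponents W Km Kp) : closure Km ∩ W ⊆ Km := by
  obtain ⟨-, -, ⟨x, hx, rfl⟩, -⟩ := h
  exact closure_connectedComponentIn_inter_subset hx

theorem disjoint (h : TwoComponents W Km Kp) : Disjoint Km Kp := by
  obtain ⟨hne, -, ⟨x, -, rfl⟩, ⟨y, -, rfl⟩, -⟩ := h
  rw [Set.disjoint_left]
  intro z hz hz'
  exact hne ((connectedComponentIn_eq hz).trans (connectedComponentIn_eq hz').symm)

theorem subset_of_isPreconnected (h : TwoComponents W Km Kp) {S : Set Ann} (hS : IsPreconnected S)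
    (hSW : S ⊆ W) {y : Ann} (hy : y ∈ S) (hyK : y ∈ Km) : S ⊆ Km := by
  obtain ⟨-, -, ⟨x, -, rfl⟩, -⟩ := h
  rw [connectedComponentIn_eq hyK]
  exact hS.subset_connectedComponentIn hy hSW

end TwoComponents

theorem isPreconnected_stdA : IsPreconnected stdA := by
  have : stdA = univ ×ˢ Icc (0 : ℝ) 1 := by
    ext p
    simp [stdA]
  rw [this]
  exact isPreconnected_univ.prod isPreconnected_Icc

/-- Reflection of the annulus exchanging the boundary components. -/
def annFlip : Ann ≃ₜ Ann := (Homeomorph.refl Circ).prodCongr (Homeomorph.subLeft (1 : ℝ))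

theorem annFlip_snd (p : Ann) : (annFlip p).2 = 1 - p.2 := rfl

theorem annFlip_annFlip (p : Ann) : annFlip (annFlip p) = p :=
  Prod.ext rfl (sub_sub_cancel 1 p.2)

theorem annFlip_mem_stdA {p : Ann} : annFlip p ∈ stdA ↔ p ∈ stdA := by
  simp only [stdA, mem_ofPred_eq, annFlip_snd, mem_Icc]
  constructor <;> rintro ⟨h1, h2⟩ <;> constructor <;> linarith

theorem mem_image_annFlip {p : Ann} {V : Set Ann} : p ∈ annFlip '' V ↔ annFlip p ∈ V := by
  constructor
  · rintro ⟨q, hq, rfl⟩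
    rwa [annFlip_annFlip]
  · exact fun h => ⟨_, h, annFlip_annFlip p⟩

/-- The version of `nonempty_homeomorph_halfOpenAnn` for neighbourhoods of the upper boundary. -/
theorem nonempty_homeomorph_halfOpenAnn_of_bdHigh {V : Set Ann} (hV : V ⊆ stdA) (hhigh : bdHigh ⊆ V)
    (hlow : Disjoint V bdLow) (hcl : IsClosed (stdA \ V)) (hVc : IsPreconnected V)
    (hcc : IsPreconnected (stdA \ V)) : Nonempty (V ≃ₜ halfOpenAnn) := by
  have hc : stdA \ annFlip '' V = annFlip '' (stdA \ V) := by
    ext p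
    rw [mem_image_annFlip, Set.mem_sdiff, Set.mem_sdiff, mem_image_annFlip, annFlip_mem_stdA]
  obtain ⟨e⟩ := nonempty_homeomorph_halfOpenAnn (V := annFlip '' V)
    (fun p hp => annFlip_mem_stdA.1 (hV (mem_image_annFlip.1 hp)))
    (fun p hp => mem_image_annFlip.2 (hhigh (by
      have : p.2 = 0 := hp
      simp [bdHigh, annFlip_snd, this])))
    (Set.disjoint_left.2 fun p hp hp1 => Set.disjoint_left.1 hlow (mem_image_annFlip.1 hp) (by
      have : p.2 = 1 := hp1
      simp [bdLow, annFlip_snd, this]))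
    (hc ▸ annFlip.isClosed_image.2 hcl)
    (hVc.image _ annFlip.continuous.continuousOn)
    (hc ▸ hcc.image _ annFlip.continuous.continuousOn)
  exact ⟨(annFlip.image V).trans e⟩

section

variable {A B : Set Ann}

/-- Unicoherence of the annulus relative to its boundary. -/
theorem isPreconnected_inter_of_union_eq_stdA (hA : IsClosed A) (hB : IsClosed B)
    (hAc : IsPreconnected A) (hBc : IsPreconnected B) (hAB : A ∪ B = stdA)
    (hlow : Disjoint B bdLow) (hhigh : Disjoint A bdHigh) (hhB : bdHigh ⊆ B) :
    IsPreconnected (A ∩ B) := by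
  have hAs : A ⊆ stdA := hAB ▸ subset_union_left
  have hBs : B ⊆ stdA := hAB ▸ subset_union_right
  have hBpos : ∀ p ∈ B, 0 < p.2 := fun p hp =>
    lt_of_le_of_ne (hBs hp).1 fun h => Set.disjoint_left.1 hlow hp h.symm
  have hAlt : ∀ p ∈ A, p.2 < 1 := fun p hp =>
    lt_of_le_of_ne (hAs hp).2 fun h => Set.disjoint_left.1 hhigh hp h
  have hqA : IsClosed (polarMap '' A) :=
    ((isCompact_stdA.of_isClosed_subset hA hAs).image continuous_polarMap).isClosed
  have hqB : IsClosed (polarMap '' B) :=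
    ((isCompact_stdA.of_isClosed_subset hB hBs).image continuous_polarMap).isClosed
  have hE : {z : ℂ | 1 ≤ ‖z‖} = polarMap '' (univ ×ˢ Ici 1) := by
    ext z
    constructor
    · exact fun hz => ⟨(argCirc z, ‖z‖), ⟨mem_univ _, hz⟩, polarMap_argCirc z⟩
    · rintro ⟨p, ⟨-, hp⟩, rfl⟩
      have hp1 : 1 ≤ p.2 := hp
      rwa [mem_ofPred_eq, norm_polarMap (zero_le_one.trans hp1)]
  have hEc : IsPreconnected {z : ℂ | 1 ≤ ‖z‖} := by
    rw [hE]
    exact (isPreconnected_univ.prod isPreconnected_Ici).image _ continuous_polarMap.continuousOn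
  have hBE : IsPreconnected (polarMap '' B ∪ {z : ℂ | 1 ≤ ‖z‖}) := by
    have h1 : ((0 : Circ), (1 : ℝ)) ∈ B := hhB rfl
    refine IsPreconnected.union (polarMap ((0 : Circ), (1 : ℝ))) ⟨_, h1, rfl⟩ ?_
      (hBc.image _ continuous_polarMap.continuousOn) hEc
    rw [mem_ofPred_eq, norm_polarMap (zero_le_one)]
  have hun : polarMap '' A ∪ (polarMap '' B ∪ {z : ℂ | 1 ≤ ‖z‖}) = univ := by
    rw [eq_univ_iff_forall]
    intro z
    rcases le_total 1 ‖z‖ with h | h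
    · exact Or.inr (Or.inr h)
    · have h1 : (argCirc z, ‖z‖) ∈ A ∪ B := hAB ▸ ⟨norm_nonneg z, h⟩
      rcases h1 with h1 | h1
      · exact Or.inl ⟨_, h1, polarMap_argCirc z⟩
      · exact Or.inr (Or.inl ⟨_, h1, polarMap_argCirc z⟩)
  have key := isPreconnected_inter_of_union_eq_univ hqA
    (hqB.union (isClosed_le continuous_const continuous_norm))
    (hAc.image _ continuous_polarMap.continuousOn) hBE hun
  have hcont : ContinuousOn (fun z : ℂ => (argCirc z, ‖z‖)) {0}ᶜ :=
    continuousOn_argCirc.prodMk continuous_norm.continuousOn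
  have hinv : ∀ p : Ann, 0 < p.2 → (argCirc (polarMap p), ‖polarMap p‖) = p := fun p hp =>
    (polarMap_injOn hp (norm_nonneg _) (polarMap_argCirc _).symm).symm
  have hinter : polarMap '' A ∩ (polarMap '' B ∪ {z : ℂ | 1 ≤ ‖z‖}) = polarMap '' (A ∩ B) := by
    ext z
    constructor
    · rintro ⟨⟨p, hp, rfl⟩, ⟨p', hp', h⟩ | h⟩
      · rw [← polarMap_injOn (hBpos p' hp') (hAs hp).1 h] at hp
        exact ⟨p', ⟨hp, hp'⟩, h⟩
      · rw [mem_ofPred_eq, norm_polarMap (hAs hp).1] at h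
        exact absurd (hAlt p hp) h.not_gt
    · rintro ⟨p, ⟨hp, hp'⟩, rfl⟩
      exact ⟨⟨p, hp, rfl⟩, Or.inl ⟨p, hp', rfl⟩⟩
  rw [hinter] at key
  have himg : (fun z : ℂ => ((argCirc z, ‖z‖) : Ann)) '' (polarMap '' (A ∩ B)) = A ∩ B := by
    rw [image_image]
    refine (image_congr fun p hp => hinv p (hBpos p hp.2)).trans (image_id' _)
  rw [← himg]
  refine key.image _ (hcont.mono ?_)
  rintro _ ⟨p, hp, rfl⟩
  rw [mem_compl_singleton_iff, ← norm_ne_zero_iff, norm_polarMap (hAs hp.1).1]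
  exact (hBpos p hp.2).ne'

theorem connectedComponentIn_sdiff_inter (hA : IsClosed A) (hB : IsClosed B)
    (hAB : A ∪ B = stdA) (hVc : IsPreconnected (A \ B)) {x : Ann} (hx : x ∈ A \ B) :
    connectedComponentIn (stdA \ (A ∩ B)) x = A \ B := by
  have hsub : A \ B ⊆ stdA \ (A ∩ B) := fun p hp =>
    ⟨hAB ▸ Or.inl hp.1, fun h => hp.2 h.2⟩
  refine Subset.antisymm ?_ (hVc.subset_connectedComponentIn hx hsub)
  have hW := connectedComponentIn_subset (stdA \ (A ∩ B)) x
  have := isPreconnected_iff_subset_of_disjoint_closed.1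
    (isPreconnected_connectedComponentIn (F := stdA \ (A ∩ B)) (x := x)) A B hA hB
    (fun p hp => hAB ▸ (hW hp).1)
    (eq_empty_of_forall_notMem fun p hp => (hW hp.1).2 hp.2)
  rcases this with h | h
  · exact fun p hp => ⟨h hp, fun hpB => (hW hp).2 ⟨h hp, hpB⟩⟩
  · exact absurd (h (mem_connectedComponentIn (hsub hx))) hx.2

/-- Two regularly closed continua covering the annulus meet in a frontier. -/
theorem isFrontierSet_inter (hA : IsClosed A) (hB : IsClosed B)
    (hAc : IsPreconnected A) (hBc : IsPreconnected B) (hAB : A ∪ B = stdA)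
    (hlow : bdLow ⊆ A \ B) (hhigh : bdHigh ⊆ B \ A) (hVm : IsPreconnected (A \ B))
    (hVp : IsPreconnected (B \ A)) (hclA : A ⊆ closure (A \ B)) (hclB : B ⊆ closure (B \ A)) :
    IsFrontierSet (A ∩ B) := by
  have hAs : A ⊆ stdA := hAB ▸ subset_union_left
  have hBs : B ⊆ stdA := hAB ▸ subset_union_right
  have hl0 : ((0 : Circ), (0 : ℝ)) ∈ A \ B := hlow rfl
  have hh0 : ((0 : Circ), (1 : ℝ)) ∈ B \ A := hhigh rfl
  have hcA : stdA \ (A \ B) = B := by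
    ext p
    rw [← hAB]
    simp only [Set.mem_sdiff, mem_union]
    tauto
  have hcB : stdA \ (B \ A) = A := by
    ext p
    rw [← hAB]
    simp only [Set.mem_sdiff, mem_union]
    tauto
  have hBA : B ∪ A = stdA := by rw [union_comm, hAB]
  have compA : ∀ x ∈ A \ B, connectedComponentIn (stdA \ (A ∩ B)) x = A \ B := fun x hx =>
    connectedComponentIn_sdiff_inter hA hB hAB hVm hx
  have compB : ∀ x ∈ B \ A, connectedComponentIn (stdA \ (A ∩ B)) x = B \ A := fun x hx => by
    rw [inter_comm]
    exact connectedComponentIn_sdiff_inter hB hA hBA hVp hx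
  have hun : A \ B ∪ B \ A = stdA \ (A ∩ B) := by
    ext p
    rw [← hAB]
    simp only [Set.mem_sdiff, mem_union, mem_inter_iff]
    tauto
  have clA : closure (A \ B) = A := Subset.antisymm (closure_minimal sdiff_subset hA) hclA
  have clB : closure (B \ A) = B := Subset.antisymm (closure_minimal sdiff_subset hB) hclB
  refine ⟨A \ B, B \ A, ⟨isCompact_stdA.of_isClosed_subset (hA.inter hB)
    (inter_subset_left.trans hAs), ⟨?_, ?_⟩, inter_subset_left.trans hAs,
    ⟨?_, hun, ⟨_, hun ▸ Or.inl hl0, compA _ hl0⟩, ⟨_, hun ▸ Or.inr hh0, compB _ hh0⟩, ?_⟩,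
    hlow, hhigh, ?_, ?_⟩, ?_, ?_⟩
  · obtain ⟨p, -, hp⟩ := isPreconnected_closed_iff.1 isPreconnected_stdA A B hA hB hAB.ge
      ⟨_, hAs hl0.1, hl0.1⟩ ⟨_, hBs hh0.1, hh0.1⟩
    exact ⟨p, hp⟩
  · exact isPreconnected_inter_of_union_eq_stdA hA hB hAc hBc hAB
      (Set.disjoint_left.2 fun p hp hl => (hlow hl).2 hp)
      (Set.disjoint_left.2 fun p hp hl => (hhigh hl).2 hp) fun p hp => (hhigh hp).1
  · intro h
    exact (h ▸ hl0).2 hl0.1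
  · intro x hx
    rw [← hun] at hx
    exact hx.imp (compA x) (compB x)
  · refine nonempty_homeomorph_halfOpenAnn (sdiff_subset.trans hAs) hlow
      (Set.disjoint_left.2 fun p hp hl => (hhigh hl).2 hp.1) ?_ hVm ?_ <;> rwa [hcA]
  · refine nonempty_homeomorph_halfOpenAnn_of_bdHigh (sdiff_subset.trans hBs) hhigh
      (Set.disjoint_left.2 fun p hp hl => (hlow hl).2 hp.1) ?_ hVp ?_ <;> rwa [hcB]
  · rw [relBd, clA, Set.sdiff_sdiff_right_self]
  · rw [relBd, clB, Set.sdiff_sdiff_right_self, inter_comm]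

end

/-- The complement of a continuum with empty interior is dense in the annulus. -/
theorem closure_union_closure_eq_stdA {K Km Kp : Set Ann} (h : AnnularContinuum K Km Kp)
    (hint : interior K = ∅) : closure Km ∪ closure Kp = stdA := by
  obtain ⟨hK, -, -, hT, hlow, hhigh, -⟩ := h
  rw [← closure_union, hT.2.1]
  refine Subset.antisymm (closure_minimal sdiff_subset isCompact_stdA.isClosed) fun p hp => ?_
  by_cases h0 : p.2 = 0
  · exact subset_closure (hT.2.1 ▸ Or.inl (hlow h0))
  by_cases h1 : p.2 = 1
  · exact subset_closure (hT.2.1 ▸ Or.inr (hhigh h1))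
  have hopen : IsOpen {p : Ann | 0 < p.2 ∧ p.2 < 1} :=
    (isOpen_lt continuous_const continuous_snd).inter (isOpen_lt continuous_snd continuous_const)
  have hd : Dense Kᶜ := interior_eq_empty_iff_dense_compl.1 hint
  have hpm : p ∈ {p : Ann | 0 < p.2 ∧ p.2 < 1} :=
    ⟨lt_of_le_of_ne hp.1 (Ne.symm h0), lt_of_le_of_ne hp.2 h1⟩
  refine closure_mono ?_ (hd.open_subset_closure_inter hopen hpm)
  rintro q ⟨⟨hq0, hq1⟩, hqK⟩
  exact ⟨⟨hq0.le, hq1.le⟩, hqK⟩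

/-- An annular continuum with empty interior contains a unique frontier. -/
theorem existsUnique_frontier_of_annular_continuum
    (K Km Kp : Set Ann) (h : AnnularContinuum K Km Kp)
    (hint : interior K = ∅) :
    ∃! Khat : Set Ann, Khat ⊆ K ∧ IsFrontierSet Khat := by
  have hAB := closure_union_closure_eq_stdA h hint
  obtain ⟨-, -, -, hT, hlow, hhigh, -⟩ := h
  have hdj := Set.disjoint_left.1 hT.disjoint
  have hm : ∀ p ∈ Km, p ∉ closure Kp := fun p hp hp' =>
    hdj hp (hT.symm.closure_inter_subset ⟨hp', hT.2.1 ▸ Or.inl hp⟩)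
  have hp : ∀ p ∈ Kp, p ∉ closure Km := fun p hp hp' =>
    hdj (hT.closure_inter_subset ⟨hp', hT.2.1 ▸ Or.inr hp⟩) hp
  have hKm : Km ⊆ closure Km \ closure Kp := fun p h => ⟨subset_closure h, hm p h⟩
  have hKp : Kp ⊆ closure Kp \ closure Km := fun p h => ⟨subset_closure h, hp p h⟩
  refine ⟨closure Km ∩ closure Kp, ⟨fun p hpp => ?_, ?_⟩, ?_⟩
  · by_contra hpK
    have : p ∈ Km ∪ Kp := hT.2.1 ▸ ⟨hAB ▸ Or.inl hpp.1, hpK⟩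
    exact this.elim (fun h => hm p h hpp.2) (fun h => hp p h hpp.1)
  · exact isFrontierSet_inter isClosed_closure isClosed_closure hT.isPreconnected.closure
      hT.symm.isPreconnected.closure hAB (hlow.trans hKm) (hhigh.trans hKp)
      (hT.isPreconnected.subset_closure hKm sdiff_subset)
      (hT.symm.isPreconnected.subset_closure hKp sdiff_subset)
      (closure_mono hKm) (closure_mono hKp)
  · rintro K' ⟨hK'K, Um, Up, ⟨-, -, hK's, hT', hlow', hhigh', -⟩, hbm, hbp⟩
    have hsub : stdA \ K ⊆ stdA \ K' := sdiff_subset_sdiff_right hK'K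
    have hmU : Km ⊆ Um := hT'.subset_of_isPreconnected hT.isPreconnected
      ((hT.2.1 ▸ subset_union_left : Km ⊆ stdA \ K).trans hsub)
      (y := ((0 : Circ), (0 : ℝ))) (hlow rfl) (hlow' rfl)
    have hpU : Kp ⊆ Up := hT'.symm.subset_of_isPreconnected hT.symm.isPreconnected
      ((hT.2.1 ▸ subset_union_right : Kp ⊆ stdA \ K).trans hsub)
      (y := ((0 : Circ), (1 : ℝ))) (hhigh rfl) (hhigh' rfl)
    have hdj' := Set.disjoint_left.1 hT'.disjoint
    have hUm : Um ⊆ closure Km := fun p hpU' => by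
      have hW : p ∈ stdA \ K' := hT'.2.1 ▸ Or.inl hpU'
      have : p ∈ closure Km ∪ closure Kp := hAB ▸ hW.1
      exact this.resolve_right fun h =>
        hdj' hpU' (hT'.symm.closure_inter_subset ⟨closure_mono hpU h, hW⟩)
    have hUp : Up ⊆ closure Kp := fun p hpU' => by
      have hW : p ∈ stdA \ K' := hT'.2.1 ▸ Or.inr hpU'
      have : p ∈ closure Km ∪ closure Kp := hAB ▸ hW.1
      exact this.resolve_left fun h =>
        hdj' (hT'.closure_inter_subset ⟨closure_mono hmU h, hW⟩) hpU'
    refine Subset.antisymm (fun p hpK => ⟨?_, ?_⟩) fun p hpp => ?_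
    · exact closure_minimal hUm isClosed_closure (hbm ▸ hpK : p ∈ relBd Um).1
    · exact closure_minimal hUp isClosed_closure (hbp ▸ hpK : p ∈ relBd Up).1
    · by_contra hpK
      have hW : p ∈ stdA \ K' := ⟨hAB ▸ Or.inl hpp.1, hpK⟩
      exact hdj' (hT'.closure_inter_subset ⟨closure_mono hmU hpp.1, hW⟩)
        (hT'.symm.closure_inter_subset ⟨closure_mono hpU hpp.2, hW⟩)
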